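/- arXiv:2404.07028 — 8 statements merged into one kernel-verified Lean document; each statement's English description precedes it below -/
import Mathlib

section
/- Let $X_i$ ($i \in \mathbb{N}$) be Polish spaces, $X = \prod_{i \in \mathbb{N}} X_i$ with the product topology, $\sigma = \bigotimes_{i \in \mathbb{N}} \sigma_i$ a product of Borel probability measures on $X$, and $f : X \to \mathbb{R}$ a bounded Borel-measurable function. Then the set $W_0(\sigma,f)$ of weak $0$-approximations of the expectation of $f$ under $\sigma$ has $\sigma$-measure $1$. -/
open MeasureTheory

/-- `μ` is the product of the measures `μs i`: the measure of every measurable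
cylinder is the product of the measures of its sides. -/
def IsProductMeasure {X : ℕ → Type*} [∀ i, MeasurableSpace (X i)]
    (μ : Measure (Π i, X i)) (μs : ∀ i, Measure (X i)) : Prop :=
  ∀ (I : Finset ℕ) (s : ∀ i, Set (X i)), (∀ i, MeasurableSet (s i)) →
    μ ((I : Set ℕ).pi s) = ∏ i ∈ I, μs i (s i)

/-- `x` is a weak `ε`-approximation of the expectation of `f` under `σ`:
for some `n`, replacing `σ` by a product measure which is the Dirac measure on `x i`
in every coordinate `i ≥ n` (and arbitrary Borel probability measures in the
coordinates `i < n`) changes the expectation of `f` by at most `ε`. -/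
def IsWeakApprox {X : ℕ → Type*} [∀ i, MeasurableSpace (X i)]
    (σ : Measure (Π i, X i)) (f : (Π i, X i) → ℝ) (ε : ℝ) (x : Π i, X i) : Prop :=
  ∃ (n : ℕ) (τs : ∀ i, Measure (X i)) (τ : Measure (Π i, X i)),
    (∀ i, IsProbabilityMeasure (τs i)) ∧
    (∀ i, n ≤ i → τs i = Measure.dirac (x i)) ∧
    IsProductMeasure τ τs ∧
    |∫ y, f y ∂τ - ∫ y, f y ∂σ| ≤ ε

lemma wz_dirac_pi {X : ℕ → Type*} [∀ i, MeasurableSpace (X i)] (u : Π i, X i)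
    (I : Finset ℕ) (s : ∀ i, Set (X i)) (hs : ∀ i, MeasurableSet (s i)) :
    (Measure.dirac u) ((I : Set ℕ).pi s) = ∏ i ∈ I, Measure.dirac (u i) (s i) := by
  classical
  rw [Measure.dirac_apply' _ (MeasurableSet.pi I.countable_toSet (fun i _ => hs i))]
  simp_rw [Measure.dirac_apply' _ (hs _)]
  by_cases h : u ∈ (I : Set ℕ).pi s
  · rw [Set.indicator_of_mem h]
    symm
    apply Finset.prod_eq_one
    intro i hi
    rw [Set.indicator_of_mem (h i hi)]
    rfl
  · rw [Set.indicator_of_notMem h]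
    simp only [Set.mem_pi, not_forall] at h
    obtain ⟨i, hi, hn⟩ := h
    symm
    apply Finset.prod_eq_zero (i := i) (by simpa using hi)
    rw [Set.indicator_of_notMem hn]

lemma wz_mix {X : ℕ → Type*} [∀ i, MeasurableSpace (X i)] (u : Π i, X i) (k : ℕ) (b : X k)
    (p q : ENNReal) (hpq : p + q = 1) :
    IsProductMeasure (p • Measure.dirac u + q • Measure.dirac (Function.update u k b))
      (Function.update (fun i => Measure.dirac (u i)) k
        (p • Measure.dirac (u k) + q • Measure.dirac b)) := by
  classical
  intro I s hs
  simp only [Measure.add_apply, Measure.smul_apply, smul_eq_mul]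
  rw [wz_dirac_pi _ _ _ hs, wz_dirac_pi _ _ _ hs]
  by_cases hk : k ∈ I
  · rw [← Finset.mul_prod_erase _ _ hk, ← Finset.mul_prod_erase _ _ hk,
      ← Finset.mul_prod_erase _ _ hk]
    have h1 : ∏ i ∈ I.erase k, Measure.dirac (Function.update u k b i) (s i)
        = ∏ i ∈ I.erase k, Measure.dirac (u i) (s i) := by
      apply Finset.prod_congr rfl
      intro i hi
      rw [Function.update_of_ne (Finset.ne_of_mem_erase hi)]
    have h2 : ∏ i ∈ I.erase k, (Function.update (fun i => Measure.dirac (u i)) k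
        (p • Measure.dirac (u k) + q • Measure.dirac b)) i (s i)
        = ∏ i ∈ I.erase k, Measure.dirac (u i) (s i) := by
      apply Finset.prod_congr rfl
      intro i hi
      rw [Function.update_of_ne (Finset.ne_of_mem_erase hi)]
    rw [h1, h2]
    simp only [Function.update_self, Measure.add_apply, Measure.smul_apply, smul_eq_mul]
    ring
  · have h1 : ∏ i ∈ I, Measure.dirac (Function.update u k b i) (s i)
        = ∏ i ∈ I, Measure.dirac (u i) (s i) := by
      apply Finset.prod_congr rfl
      intro i hi
      rw [Function.update_of_ne (by rintro rfl; exact hk hi)]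
    have h2 : ∏ i ∈ I, (Function.update (fun i => Measure.dirac (u i)) k
        (p • Measure.dirac (u k) + q • Measure.dirac b)) i (s i)
        = ∏ i ∈ I, Measure.dirac (u i) (s i) := by
      apply Finset.prod_congr rfl
      intro i hi
      rw [Function.update_of_ne (by rintro rfl; exact hk hi)]
    rw [h1, h2, ← add_mul, hpq, one_mul]

lemma wz_hit1 {X : ℕ → Type*} [∀ i, MeasurableSpace (X i)]
    (σ : Measure (Π i, X i)) (f : (Π i, X i) → ℝ) (hf : Measurable f)
    (x u : Π i, X i) (n k : ℕ) (b : X k) (hu : ∀ i, n ≤ i → u i = x i)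
    (h1 : f u ≤ ∫ y, f y ∂σ) (h2 : ∫ y, f y ∂σ ≤ f (Function.update u k b)) :
    IsWeakApprox σ f 0 x := by
  classical
  set c := ∫ y, f y ∂σ with hc
  obtain ⟨p, q, hp, hq, hpq, hcomb⟩ :
      ∃ p q : ℝ, 0 ≤ p ∧ 0 ≤ q ∧ p + q = 1 ∧ p * f u + q * f (Function.update u k b) = c := by
    have : c ∈ segment ℝ (f u) (f (Function.update u k b)) := by
      rw [segment_eq_Icc (h1.trans h2)]; exact ⟨h1, h2⟩
    obtain ⟨p, q, hp, hq, hpq, h⟩ := this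
    exact ⟨p, q, hp, hq, hpq, by simpa using h⟩
  have hpq' : ENNReal.ofReal p + ENNReal.ofReal q = 1 := by
    rw [← ENNReal.ofReal_add hp hq, hpq, ENNReal.ofReal_one]
  have hint : ∀ z, Integrable f (Measure.dirac z) := fun z =>
    integrable_dirac' hf.stronglyMeasurable (by simp)
  refine ⟨n + k + 1, _, _, ?_, ?_, wz_mix u k b _ _ hpq', ?_⟩
  · intro i
    by_cases hi : i = k
    · subst hi
      rw [Function.update_self]
      constructor
      simp [hpq']
    · rw [Function.update_of_ne hi]
      infer_instance
  · intro i hi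
    rw [Function.update_of_ne (by omega), hu i (by omega)]
  · rw [integral_add_measure ((hint _).smul_measure (by simp)) ((hint _).smul_measure (by simp)),
      integral_smul_measure, integral_smul_measure,
      integral_dirac' _ _ hf.stronglyMeasurable, integral_dirac' _ _ hf.stronglyMeasurable,
      ENNReal.toReal_ofReal hp, ENNReal.toReal_ofReal hq]
    simp only [smul_eq_mul, hcomb]
    simp [hc]

lemma wz_hit {X : ℕ → Type*} [∀ i, MeasurableSpace (X i)]
    (σ : Measure (Π i, X i)) (f : (Π i, X i) → ℝ) (hf : Measurable f)
    (x u v : Π i, X i) (n : ℕ) (hu : ∀ i, n ≤ i → u i = x i) (hv : ∀ i, n ≤ i → v i = x i)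
    (h1 : f u ≤ ∫ y, f y ∂σ) (h2 : ∫ y, f y ∂σ ≤ f v) :
    IsWeakApprox σ f 0 x := by
  classical
  set y : ℕ → Π i, X i := fun k i => if i < k then v i else u i with hy
  have hyn : y n = v := by
    funext i
    by_cases hi : i < n
    · simp [hy, hi]
    · simp [hy, hi, hu i (by omega), hv i (by omega)]
  have hy0 : y 0 = u := by
    funext i; simp [hy]
  have hex : ∃ k, ∫ y, f y ∂σ ≤ f (y k) := ⟨n, by rw [hyn]; exact h2⟩
  have hspec := Nat.find_spec hex
  have hmin := fun m => Nat.find_min hex (m := m)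
  generalize Nat.find hex = k at hspec hmin
  cases k with
  | zero =>
    rw [hy0] at hspec
    exact wz_hit1 σ f hf x u n 0 (u 0) hu h1 (by rwa [Function.update_eq_self])
  | succ j =>
    have hlt := hmin j (Nat.lt_succ_self j)
    refine wz_hit1 σ f hf x (y j) n j (v j) ?_ (not_le.mp hlt).le ?_
    · intro i hi
      by_cases hij : i < j
      · simp [hy, hij, hv i hi]
      · simp [hy, hij, hu i hi]
    · convert hspec using 2
      funext i
      by_cases hi : i = j
      · subst hi; simp [hy]
      · rw [Function.update_of_ne hi]
        simp only [hy]
        have : i < j ↔ i < j + 1 := by omega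
        simp [this]

def wzT {X : ℕ → Type*} (n : ℕ) (z : (Π i, X i) × (Π i, X i)) : Π i, X i :=
  fun i => if i < n then z.2 i else z.1 i

lemma wzT_meas {X : ℕ → Type*} [∀ i, MeasurableSpace (X i)] (n : ℕ) :
    Measurable (wzT (X := X) n) := by
  rw [measurable_pi_iff]
  intro i
  by_cases h : i < n
  · simp only [wzT, h, if_true]; fun_prop
  · simp only [wzT, h, if_false]; fun_prop

lemma wzT_map {X : ℕ → Type*} [∀ i, MeasurableSpace (X i)] (n : ℕ)
    (σs : ∀ i, Measure (X i)) [∀ i, IsProbabilityMeasure (σs i)] :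
    ((Measure.infinitePi σs).prod (Measure.infinitePi σs)).map (wzT n)
      = Measure.infinitePi σs := by
  classical
  apply Measure.eq_infinitePi
  intro I s hs
  rw [Measure.map_apply (wzT_meas n) (MeasurableSet.pi I.countable_toSet (fun i _ => hs i))]
  have : wzT n ⁻¹' ((I : Set ℕ).pi s) =
      ((I.filter (fun i => ¬ i < n) : Finset ℕ) : Set ℕ).pi s ×ˢ
        ((I.filter (fun i => i < n) : Finset ℕ) : Set ℕ).pi s := by
    ext z
    simp only [Set.mem_preimage, Set.mem_pi, Set.mem_prod, Finset.mem_coe, Finset.mem_filter, wzT]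
    constructor
    · intro h
      refine ⟨fun i hi => ?_, fun i hi => ?_⟩
      · simpa [hi.2] using h i hi.1
      · simpa [hi.2] using h i hi.1
    · rintro ⟨h1, h2⟩ i hi
      by_cases hn : i < n
      · simpa [hn] using h2 i ⟨hi, hn⟩
      · simpa [hn] using h1 i ⟨hi, hn⟩
  rw [this, Measure.prod_prod, Measure.infinitePi_pi _ (fun i _ => hs i),
    Measure.infinitePi_pi _ (fun i _ => hs i), mul_comm,
    Finset.prod_filter_mul_prod_filter_not]

lemma wz_zero_one {X : ℕ → Type*} [∀ i, MeasurableSpace (X i)]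
    (σs : ∀ i, Measure (X i)) [∀ i, IsProbabilityMeasure (σs i)]
    (P : Set (Π i, X i)) (hP : MeasurableSet P) :
    (∀ᵐ x ∂Measure.infinitePi σs, ¬ ∀ n y, (∀ i, n ≤ i → y i = x i) → y ∈ P) ∨
      ∀ᵐ x ∂Measure.infinitePi σs, x ∈ P := by
  classical
  set σ := Measure.infinitePi σs with hσ
  set h : ℕ → (Π i, X i) → ENNReal := fun n x => σ (Prod.mk x ⁻¹' (wzT n ⁻¹' Pᶜ)) with hh
  have hm : ∀ n, Measurable (h n) := fun n =>
    measurable_measure_prodMk_left (wzT_meas n hP.compl)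
  set B : ℕ → Set (Π i, X i) := fun n => {x | h n x = 0} with hB
  have hBm : ∀ n, MeasurableSet (B n) := fun n => hm n (measurableSet_singleton 0)
  -- f positive almost surely on B n
  have hBP : ∀ n, ∀ᵐ z ∂σ, z ∈ B n → z ∈ P := by
    intro n
    have hset : MeasurableSet {z | z ∈ B n → z ∈ P} := by
      have : {z | z ∈ B n → z ∈ P} = (B n)ᶜ ∪ P := by
        ext z; simp [imp_iff_not_or]
      rw [this]; exact (hBm n).compl.union hP
    have key : ∀ᵐ z ∂(σ.prod σ).map (wzT n), z ∈ B n → z ∈ P := by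
      rw [ae_map_iff (wzT_meas n).aemeasurable hset,
        Measure.ae_prod_iff_ae_ae (p := fun z => wzT n z ∈ B n → wzT n z ∈ P) (wzT_meas n hset)]
      refine Filter.Eventually.of_forall fun x => ?_
      have hTx : ∀ y, h n (wzT n (x, y)) = h n x := by
        intro y
        simp only [hh]
        congr 1
        ext w
        have : wzT n (wzT n (x, y), w) = wzT n (x, w) := by
          funext i
          by_cases hi : i < n <;> simp [wzT, hi]
        simp [this]
      by_cases hx : h n x = 0
      · have : ∀ᵐ y ∂σ, wzT n (x, y) ∈ P := by
          rw [ae_iff]; exact hx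
        filter_upwards [this] with y hy _ using hy
      · refine Filter.Eventually.of_forall fun y hy => ?_
        exact absurd ((hTx y).symm.trans hy) hx
    rwa [wzT_map n σs] at key
  -- tail measurability
  set s : ℕ → MeasurableSpace (Π i, X i) :=
    fun i => MeasurableSpace.comap (fun x => x i) inferInstance with hs
  have hind : ProbabilityTheory.iIndep s σ := by
    have : ProbabilityTheory.iIndepFun (fun i (x : Π i, X i) => x i) σ := by
      rw [ProbabilityTheory.iIndepFun_iff_map_fun_eq_infinitePi_map (by fun_prop)]
      have h1 : ∀ i, σ.map (fun x => x i) = σs i := fun i =>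
        (measurePreserving_eval_infinitePi σs i).map_eq
      simp_rw [h1]
      exact Measure.map_id
    exact this
  have hle : ∀ n, s n ≤ MeasurableSpace.pi := fun n => (measurable_pi_apply n).comap_le
  rcases isEmpty_or_nonempty (Π i, X i) with he | ⟨⟨x0⟩⟩
  · left; exact Filter.Eventually.of_forall fun x => (he.false x).elim
  have htailn : ∀ N n, N ≤ n → MeasurableSet[⨆ i, ⨆ (_ : i ≥ N), s i] (B n) := by
    intro N n hn
    have hg : @Measurable _ _ (⨆ i, ⨆ (_ : i ≥ N), s i) MeasurableSpace.pi
        (fun x : Π i, X i => wzT n (x, x0)) := by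
      refine @measurable_pi_lambda _ _ _ (⨆ i, ⨆ (_ : i ≥ N), s i) _ _ ?_
      intro i
      by_cases hi : i < n
      · simp only [wzT, hi, if_true]
        exact @measurable_const _ _ _ (⨆ i, ⨆ (_ : i ≥ N), s i) _
      · simp only [wzT, hi, if_false]
        rw [measurable_iff_comap_le]
        exact le_iSup₂_of_le (f := fun i (_ : i ≥ N) => s i) i (by omega) le_rfl
    have := hg (hBm n)
    convert this using 1
    ext x
    simp only [hB, Set.mem_preimage, Set.mem_ofPred_eq, hh]
    have e : ∀ w, wzT n (wzT n (x, x0), w) = wzT n (x, w) := by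
      intro w
      funext i
      by_cases hi : i < n <;> simp [wzT, hi]
    have e2 : Prod.mk (wzT n (x, x0)) ⁻¹' (wzT n ⁻¹' Pᶜ) = Prod.mk x ⁻¹' (wzT n ⁻¹' Pᶜ) := by
      ext w; simp [e]
    rw [e2]
  set L : Set (Π i, X i) := {x | ∃ᶠ n in Filter.atTop, x ∈ B n} with hL
  have hLtail : MeasurableSet[Filter.limsup s Filter.atTop] L := by
    rw [Filter.limsup_eq_iInf_iSup_of_nat, MeasurableSpace.measurableSet_iInf]
    intro N
    have : L = ⋂ M, ⋃ n, ⋃ (_ : N + M ≤ n), B n := by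
      ext x
      simp only [hL, Set.mem_ofPred_eq, Filter.frequently_atTop, Set.mem_iInter, Set.mem_iUnion,
        exists_prop]
      constructor
      · intro h M
        exact h (N + M)
      · intro h M
        obtain ⟨n, h1, h2⟩ := h M
        exact ⟨n, by omega, h2⟩
    rw [this]
    refine @MeasurableSet.iInter _ _ (⨆ i, ⨆ (_ : i ≥ N), s i) _ _ fun M => ?_
    refine @MeasurableSet.iUnion _ _ (⨆ i, ⨆ (_ : i ≥ N), s i) _ _ fun n => ?_
    refine @MeasurableSet.iUnion _ _ (⨆ i, ⨆ (_ : i ≥ N), s i) _ _ fun hn => ?_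
    exact htailn N n (by omega)
  have hLm : MeasurableSet L := by
    have : Filter.limsup s Filter.atTop ≤ MeasurableSpace.pi := by
      rw [Filter.limsup_eq_iInf_iSup_of_nat]
      exact (iInf_le _ 0).trans (iSup₂_le fun i _ => hle i)
    exact this _ hLtail
  rcases ProbabilityTheory.measure_zero_or_one_of_measurableSet_limsup_atTop hle hind hLtail
    with h0 | h1
  · left
    filter_upwards [measure_eq_zero_iff_ae_notMem.mp h0] with x hx hall
    apply hx
    apply Filter.Frequently.of_forall
    intro n
    have : Prod.mk x ⁻¹' (wzT n ⁻¹' Pᶜ) = ∅ := by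
      ext w
      simp only [Set.mem_preimage, Set.mem_compl_iff, Set.mem_empty_iff_false, iff_false, not_not]
      exact hall n _ (fun i hi => by simp [wzT, not_lt.mpr hi])
    change σ (Prod.mk x ⁻¹' (wzT n ⁻¹' Pᶜ)) = 0
    rw [this, measure_empty]
  · right
    have h1' : ∀ᵐ x ∂σ, x ∈ L := (mem_ae_iff_prob_eq_one hLm).mpr h1
    filter_upwards [h1', ae_all_iff.mpr hBP] with x hx hall
    obtain ⟨n, hn⟩ := hx.exists
    exact hall n hn

lemma wz_not_ae_lt {Ω : Type*} [MeasurableSpace Ω] (μ : Measure Ω) [IsProbabilityMeasure μ]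
    (f : Ω → ℝ) (hf : Integrable f μ) (h : ∀ᵐ x ∂μ, ∫ y, f y ∂μ < f x) : False := by
  have hi : Integrable (fun x => f x - ∫ y, f y ∂μ) μ := hf.sub (integrable_const _)
  have h0 : ∫ x, (f x - ∫ y, f y ∂μ) ∂μ = 0 := by
    rw [integral_sub hf (integrable_const _)]; simp
  rw [integral_eq_zero_iff_of_nonneg_ae (by filter_upwards [h] with x hx; simpa using hx.le) hi]
    at h0
  have : ∀ᵐ x ∂μ, False := by
    filter_upwards [h, h0] with x h1 h2
    simp only [Pi.zero_apply] at h2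
    linarith
  obtain ⟨x, hx⟩ := this.exists
  exact hx

theorem weak_zero_approx_measure_one
    (X : ℕ → Type*) [∀ i, TopologicalSpace (X i)] [∀ i, PolishSpace (X i)]
    [∀ i, MeasurableSpace (X i)] [∀ i, BorelSpace (X i)]
    (σs : ∀ i, Measure (X i)) (hσs : ∀ i, IsProbabilityMeasure (σs i))
    (σ : Measure (Π i, X i)) (hσ : IsProductMeasure σ σs)
    (f : (Π i, X i) → ℝ) (hf : Measurable f) (C : ℝ) (hbd : ∀ x, |f x| ≤ C) :
    σ {x | IsWeakApprox σ f 0 x} = 1 := by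
  have hσe : σ = Measure.infinitePi σs := Measure.eq_infinitePi _ hσ
  subst hσe
  have hint : Integrable f (Measure.infinitePi σs) :=
    Integrable.of_bound hf.aestronglyMeasurable C (Filter.Eventually.of_forall hbd)
  set c := ∫ y, f y ∂(Measure.infinitePi σs) with hc
  have h1 := (wz_zero_one σs {x | c < f x} (measurableSet_lt measurable_const hf)).resolve_right
    (fun h => wz_not_ae_lt _ f hint h)
  have h2 := (wz_zero_one σs {x | f x < c} (measurableSet_lt hf measurable_const)).resolve_right
    (fun h => wz_not_ae_lt (Measure.infinitePi σs) (fun x => - f x) hint.neg (by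
      rw [integral_neg]
      filter_upwards [h] with x hx
      exact neg_lt_neg hx))
  have hW : ∀ᵐ x ∂(Measure.infinitePi σs),
      x ∈ {x | IsWeakApprox (Measure.infinitePi σs) f 0 x} := by
    filter_upwards [h1, h2] with x hx1 hx2
    push Not at hx1 hx2
    obtain ⟨n, u, hu, hu'⟩ := hx1
    obtain ⟨m, v, hv, hv'⟩ := hx2
    exact wz_hit _ f hf x u v (n + m) (fun i hi => hu i (by omega)) (fun i hi => hv i (by omega))
      hu' hv'
  have := measure_congr (Filter.eventuallyEq_univ.mpr hW)
  exact this.trans measure_univ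
end

section
/- Let $X_i$ ($i \in \mathbb{N}$) be Polish spaces, $X = \prod_{i \in \mathbb{N}} X_i$, $\sigma = \bigotimes_{i \in \mathbb{N}} \sigma_i$ a product of Borel probability measures on $X$, $f : X \to \mathbb{R}$ a bounded Borel-measurable function, and $\varepsilon > 0$. Then the set $S_\varepsilon(\sigma,f)$ of strong $\varepsilon$-approximations of the expectation of $f$ under $\sigma$ has $\sigma$-measure $1$. -/
open MeasureTheory

/-- `x` is a strong `ε`-approximation of the expectation of `f` under the product of
the `σs i`: for some `n`, replacing the coordinates `i ≥ n` of the product measure by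
the Dirac measures on `x i` changes the expectation of `f` by at most `ε`. -/
def IsStrongApprox {X : ℕ → Type*} [∀ i, MeasurableSpace (X i)]
    (σs : ∀ i, Measure (X i)) (σ : Measure (Π i, X i))
    (f : (Π i, X i) → ℝ) (ε : ℝ) (x : Π i, X i) : Prop :=
  ∃ (n : ℕ) (τ : Measure (Π i, X i)),
    IsProductMeasure τ (fun i => if i < n then σs i else Measure.dirac (x i)) ∧
    |∫ y, f y ∂τ - ∫ y, f y ∂σ| ≤ ε

def mixFn {X : ℕ → Type*} (n : ℕ) (y x : Π i, X i) : Π i, X i :=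
  fun i => if i < n then y i else x i

theorem measurable_mixFn {X : ℕ → Type*} [∀ i, MeasurableSpace (X i)] (n : ℕ) :
    Measurable (fun p : (Π i, X i) × (Π i, X i) => mixFn n p.1 p.2) := by
  refine measurable_pi_lambda _ fun i => ?_
  by_cases h : i < n
  · simp only [mixFn, h, if_true]; fun_prop
  · simp only [mixFn, h, if_false]; fun_prop

theorem map_mixFn {X : ℕ → Type*} [∀ i, MeasurableSpace (X i)]
    (σs : ∀ i, Measure (X i)) (hσs : ∀ i, IsProbabilityMeasure (σs i))
    (σ : Measure (Π i, X i)) [IsProbabilityMeasure σ] (hσ : IsProductMeasure σ σs) (n : ℕ) :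
    (σ.prod σ).map (fun p => mixFn n p.1 p.2) = σ := by
  have h1 : σ = Measure.infinitePi σs := Measure.eq_infinitePi _ hσ
  refine Eq.trans (Measure.eq_infinitePi σs ?_) h1.symm
  intro I t ht
  rw [Measure.map_apply (measurable_mixFn n) (MeasurableSet.pi I.countable_toSet fun i _ => ht i)]
  have : (fun p : (Π i, X i) × (Π i, X i) => mixFn n p.1 p.2) ⁻¹' ((I : Set ℕ).pi t)
      = ((I.filter (· < n) : Finset ℕ) : Set ℕ).pi t ×ˢ
        ((I.filter (fun i => ¬ i < n) : Finset ℕ) : Set ℕ).pi t := by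
    ext p
    simp only [Set.mem_preimage, Set.mem_pi, Set.mem_prod, mixFn, Finset.mem_coe,
      Finset.mem_filter]
    constructor
    · intro h
      refine ⟨fun i hi => ?_, fun i hi => ?_⟩
      · have := h i hi.1
        rwa [if_pos hi.2] at this
      · have := h i hi.1
        rwa [if_neg hi.2] at this
    · rintro ⟨h, h'⟩ i hi
      split_ifs with hn
      · exact h i ⟨hi, hn⟩
      · exact h' i ⟨hi, hn⟩
  rw [this, Measure.prod_prod, hσ _ _ ht, hσ _ _ ht, Finset.prod_filter_mul_prod_filter_not]

theorem isProductMeasure_map_mixFn {X : ℕ → Type*} [∀ i, MeasurableSpace (X i)]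
    (σs : ∀ i, Measure (X i))
    (σ : Measure (Π i, X i)) (hσ : IsProductMeasure σ σs) (n : ℕ) (x : Π i, X i) :
    IsProductMeasure (σ.map (fun y => mixFn n y x))
      (fun i => if i < n then σs i else Measure.dirac (x i)) := by
  classical
  have hm : Measurable (fun y => mixFn n y x) :=
    (measurable_mixFn n).comp (measurable_id.prodMk measurable_const)
  intro I t ht
  rw [Measure.map_apply hm (MeasurableSet.pi I.countable_toSet fun i _ => ht i),
    ← Finset.prod_filter_mul_prod_filter_not I (· < n)]
  have e1 : ∏ i ∈ I with i < n, (if i < n then σs i else Measure.dirac (x i)) (t i)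
      = ∏ i ∈ I with i < n, σs i (t i) :=
    Finset.prod_congr rfl fun i hi => by rw [if_pos (Finset.mem_filter.1 hi).2]
  have e2 : ∏ i ∈ I with ¬ i < n, (if i < n then σs i else Measure.dirac (x i)) (t i)
      = ∏ i ∈ I with ¬ i < n, (t i).indicator 1 (x i) :=
    Finset.prod_congr rfl fun i hi => by
      rw [if_neg (Finset.mem_filter.1 hi).2, Measure.dirac_apply' _ (ht i)]
  rw [e1, e2, ← hσ _ _ ht]
  by_cases hx : ∀ i ∈ I, ¬ i < n → x i ∈ t i
  · rw [Finset.prod_eq_one, mul_one]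
    · congr 1
      ext y
      simp only [Set.mem_preimage, Set.mem_pi, mixFn, Finset.mem_coe, Finset.mem_filter]
      constructor
      · intro h i hi
        have := h i hi.1
        rwa [if_pos hi.2] at this
      · intro h i hi
        split_ifs with hn
        · exact h i ⟨hi, hn⟩
        · exact hx i hi hn
    · intro i hi
      rw [Finset.mem_filter] at hi
      simp [hx i hi.1 hi.2]
  · push Not at hx
    obtain ⟨i, hi, hn, hxi⟩ := hx
    rw [Finset.prod_eq_zero (i := i) (Finset.mem_filter.2 ⟨hi, not_lt.2 hn⟩) (by simp [hxi]),
      mul_zero]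
    convert measure_empty (μ := σ)
    ext y
    simp only [Set.mem_preimage, Set.mem_pi, mixFn, Finset.mem_coe, Set.mem_empty_iff_false,
      iff_false]
    intro h
    have := h i hi
    rw [if_neg (not_lt.2 hn)] at this
    exact hxi this

theorem iSup_piLE {X : ℕ → Type*} [∀ i, MeasurableSpace (X i)] :
    (⨆ n, (Filtration.piLE (X := X)) n) = MeasurableSpace.pi := by
  refine le_antisymm (iSup_le fun n => Filtration.piLE.le n) ?_
  refine iSup_le fun i => le_trans ?_ (le_iSup _ i)
  have : (fun x : Π i, X i => x i) = (fun z : Π j : Set.Iic i, X j => z (⟨i, Set.mem_Iic.2 le_rfl⟩ : Set.Iic i)) ∘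
      Preorder.restrictLe i := rfl
  rw [this, ← MeasurableSpace.comap_comp]
  refine MeasurableSpace.comap_mono (Measurable.comap_le ?_)
  exact measurable_pi_apply (X := fun j : Set.Iic i => X j) (⟨i, Set.mem_Iic.2 le_rfl⟩ : Set.Iic i)

theorem strong_eps_approx_measure_one
    (X : ℕ → Type*) [∀ i, TopologicalSpace (X i)] [∀ i, PolishSpace (X i)]
    [∀ i, MeasurableSpace (X i)] [∀ i, BorelSpace (X i)]
    (σs : ∀ i, Measure (X i)) (hσs : ∀ i, IsProbabilityMeasure (σs i))
    (σ : Measure (Π i, X i)) (hσ : IsProductMeasure σ σs)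
    (f : (Π i, X i) → ℝ) (hf : Measurable f) (C : ℝ) (hbd : ∀ x, |f x| ≤ C)
    (ε : ℝ) (hε : 0 < ε) :
    σ {x | IsStrongApprox σs σ f ε x} = 1 := by
  have hprob : IsProbabilityMeasure σ := ⟨by
    have := hσ ∅ (fun _ => Set.univ) (fun _ => MeasurableSet.univ)
    simpa using this⟩
  have hfi : Integrable f σ :=
    Integrable.of_bound hf.aestronglyMeasurable C (ae_of_all _ hbd)
  let F : ℕ → (Π i, X i) → ℝ := fun N => σ[f | Filtration.piLE N]
  have hFm : ∀ N, StronglyMeasurable (F N) := fun N =>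
    stronglyMeasurable_condExp.mono (Filtration.piLE.le N)
  have hFi : ∀ N, Integrable (F N) σ := fun N => integrable_condExp
  have hFE : ∀ N, ∫ y, F N y ∂σ = ∫ y, f y ∂σ := fun N =>
    integral_condExp (Filtration.piLE.le N)
  have hFd : ∀ N y x, F N (mixFn (N + 1) y x) = F N y := by
    intro N y x
    have hd : DependsOn (F N) (Set.Iic N) :=
      StronglyMeasurable.dependsOn_of_piLE stronglyMeasurable_condExp
    refine hd fun i hi => ?_
    have : i < N + 1 := Nat.lt_succ_of_le hi
    simp [mixFn, this]
  have hlim : Filter.Tendsto (fun N => eLpNorm (F N - f) 1 σ) Filter.atTop (nhds 0) :=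
    hfi.tendsto_eLpNorm_condExp (by rw [iSup_piLE]; exact hf.stronglyMeasurable)
  let G : ℕ → (Π i, X i) → (Π i, X i) → ENNReal := fun N x y =>
    ‖(F N - f) (mixFn (N + 1) y x)‖ₑ
  have hDm : ∀ N, Measurable (fun z => ‖(F N - f) z‖ₑ) := fun N =>
    ((hFm N).measurable.sub hf).enorm
  have hGm : ∀ N, Measurable (fun p : (Π i, X i) × (Π i, X i) => G N p.2 p.1) := fun N =>
    (hDm N).comp (measurable_mixFn (N + 1))
  have hGi : ∀ N, ∫⁻ x, ∫⁻ y, G N x y ∂σ ∂σ = eLpNorm (F N - f) 1 σ := by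
    intro N
    rw [eLpNorm_one_eq_lintegral_enorm]
    conv_rhs => rw [← map_mixFn σs hσs σ hσ (N + 1)]
    rw [lintegral_map (hDm N) (measurable_mixFn _), lintegral_prod_symm' _ (hGm N)]
  have hsub : ∀ N, {x | IsStrongApprox σs σ f ε x}ᶜ ⊆
      {x | ENNReal.ofReal ε ≤ ∫⁻ y, G N x y ∂σ} := by
    intro N x hx
    by_contra hlt
    apply hx
    simp only [Set.mem_ofPred_eq, not_le] at hlt
    have hm : Measurable (fun y => mixFn (N + 1) y x) :=
      (measurable_mixFn _).comp (measurable_id.prodMk measurable_const)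
    have hgi : Integrable (fun y => f (mixFn (N + 1) y x)) σ :=
      Integrable.of_bound (hf.comp hm).aestronglyMeasurable C (ae_of_all _ fun y => hbd _)
    refine ⟨N + 1, _, isProductMeasure_map_mixFn σs σ hσ (N + 1) x, ?_⟩
    rw [integral_map hm.aemeasurable hf.aestronglyMeasurable, ← hFE N, abs_sub_comm,
      ← integral_sub (hFi N) hgi]
    have h2 := enorm_integral_le_lintegral_enorm (μ := σ)
      (fun y => F N y - f (mixFn (N + 1) y x))
    have h3 : ∫⁻ y, ‖F N y - f (mixFn (N + 1) y x)‖ₑ ∂σ = ∫⁻ y, G N x y ∂σ := by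
      refine lintegral_congr fun y => ?_
      simp only [G, Pi.sub_apply, hFd]
    rw [h3] at h2
    have h4 := h2.trans hlt.le
    rw [Real.enorm_eq_ofReal_abs] at h4
    exact (ENNReal.ofReal_le_ofReal_iff hε.le).1 h4
  have hε' : ENNReal.ofReal ε ≠ 0 := by simpa using hε
  have hle : ∀ N, ENNReal.ofReal ε * σ {x | IsStrongApprox σs σ f ε x}ᶜ
      ≤ eLpNorm (F N - f) 1 σ := by
    intro N
    refine le_trans (mul_le_mul_right (measure_mono (hsub N)) _) ?_
    refine (mul_meas_ge_le_lintegral₀ ?_ _).trans (hGi N).le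
    exact (hGm N).lintegral_prod_left'.aemeasurable
  have h0 : ENNReal.ofReal ε * σ {x | IsStrongApprox σs σ f ε x}ᶜ = 0 :=
    le_antisymm (ge_of_tendsto' hlim hle) (zero_le)
  have h1 := (mul_eq_zero.1 h0).resolve_left hε'
  have h5 : {x | IsStrongApprox σs σ f ε x} =ᵐ[σ] Set.univ := by
    rw [ae_eq_univ]; exact h1
  rw [measure_congr h5, measure_univ]
end

section
/- Consider a strategic-form game with player set $\{0\} \cup \mathbb{N}$, where player $0$ has a nonempty finite action set $A$, each player $i \in \mathbb{N}$ has a Polish action space $X_i$, and player $0$'s payoff $u : A \times X \to \mathbb{R}$ is bounded and Borel-measurable, with $X = \prod_{i \in \mathbb{N}} X_i$. Then the minmax value $v = \inf_{\sigma \in \Sigma} \max_{a \in A} \mathbb{E}_{\delta_a \otimes \sigma}[u]$ equals the finitistic minmax value $v^* = \inf_{\sigma \in \Sigma^*} \max_{a \in A} \mathbb{E}_{\delta_a \otimes \sigma}[u]$. -/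
open MeasureTheory

/-- The set `Σ` of product Borel probability measures on `Π i, X i`. -/
def ProductProbSet (X : ℕ → Type*) [∀ i, MeasurableSpace (X i)] :
    Set (Measure (Π i, X i)) :=
  {σ | ∃ σs : ∀ i, Measure (X i),
    (∀ i, IsProbabilityMeasure (σs i)) ∧ IsProductMeasure σ σs}

/-- The set `Σ*` of product Borel probability measures on `Π i, X i` in which all
but finitely many factors are Dirac measures. -/
def FinitisticProductProbSet (X : ℕ → Type*) [∀ i, MeasurableSpace (X i)] :
    Set (Measure (Π i, X i)) :=
  {σ | ∃ σs : ∀ i, Measure (X i),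
    (∀ i, IsProbabilityMeasure (σs i)) ∧ IsProductMeasure σ σs ∧
    {i | ¬ ∃ xi : X i, σs i = Measure.dirac xi}.Finite}

section helpers

/-- Coordinates up to `n` from the second point, the rest from the first. -/
def splicePt {X : ℕ → Type*} (n : ℕ) (p : (Π i, X i) × (Π i, X i)) : Π i, X i :=
  fun i => if i ≤ n then p.2 i else p.1 i

lemma measurable_splicePt {X : ℕ → Type*} [∀ i, MeasurableSpace (X i)] (n : ℕ) :
    Measurable (splicePt (X := X) n) := by
  refine measurable_pi_lambda _ fun i => ?_
  unfold splicePt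
  split_ifs <;> fun_prop

lemma IsProductMeasure.splice {X : ℕ → Type*} [∀ i, MeasurableSpace (X i)]
    {μ ν : Measure (Π i, X i)} {μs νs : ∀ i, Measure (X i)} [SFinite μ] [SFinite ν]
    (hμ : IsProductMeasure μ μs) (hν : IsProductMeasure ν νs) (n : ℕ) :
    IsProductMeasure ((μ.prod ν).map (splicePt n)) (fun i => if i ≤ n then νs i else μs i) := by
  intro I s hs
  have hm : MeasurableSet ((I : Set ℕ).pi s) :=
    MeasurableSet.pi I.countable_toSet fun i _ => hs i
  rw [Measure.map_apply (measurable_splicePt n) hm]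
  have : splicePt n ⁻¹' ((I : Set ℕ).pi s) =
      (((I.filter fun i => ¬ i ≤ n : Finset ℕ) : Set ℕ).pi s) ×ˢ
      (((I.filter fun i => i ≤ n : Finset ℕ) : Set ℕ).pi s) := by
    ext p
    simp only [Set.mem_preimage, Set.mem_pi, Set.mem_prod, Finset.mem_coe, Finset.mem_filter,
      splicePt]
    constructor
    · intro h
      refine ⟨fun i hi => ?_, fun i hi => ?_⟩
      · simpa [hi.2] using h i hi.1
      · simpa [hi.2] using h i hi.1
    · rintro ⟨h1, h2⟩ i hi
      split_ifs with h
      · exact h2 i ⟨hi, h⟩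
      · exact h1 i ⟨hi, h⟩
  rw [this, Measure.prod_prod, hμ _ s hs, hν _ s hs,
    ← Finset.prod_filter_mul_prod_filter_not I (fun i => i ≤ n), mul_comm]
  congr 1
  · exact Finset.prod_congr rfl fun i hi => by simp [(Finset.mem_filter.1 hi).2]
  · exact Finset.prod_congr rfl fun i hi => by
      have := (Finset.mem_filter.1 hi).2
      simp only [this, if_false]

lemma isProductMeasure_dirac {X : ℕ → Type*} [∀ i, MeasurableSpace (X i)] (x : Π i, X i) :
    IsProductMeasure (Measure.dirac x) (fun i => Measure.dirac (x i)) := by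
  intro I s hs
  have hm : MeasurableSet ((I : Set ℕ).pi s) :=
    MeasurableSet.pi I.countable_toSet fun i _ => hs i
  classical
  rw [Measure.dirac_apply' _ hm]
  simp only [Measure.dirac_apply' _ (hs _)]
  by_cases h : x ∈ (I : Set ℕ).pi s
  · rw [Set.indicator_of_mem h]
    refine (Finset.prod_eq_one fun i hi => ?_).symm
    rw [Set.indicator_of_mem (h i hi)]; rfl
  · rw [Set.indicator_of_notMem h]
    simp only [Set.mem_pi, not_forall] at h
    obtain ⟨i, hi, hx⟩ := h
    exact (Finset.prod_eq_zero hi (Set.indicator_of_notMem hx _)).symm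

lemma IsProductMeasure.isProb {X : ℕ → Type*} [∀ i, MeasurableSpace (X i)]
    {μ : Measure (Π i, X i)} {μs : ∀ i, Measure (X i)} (h : IsProductMeasure μ μs) :
    IsProbabilityMeasure μ :=
  ⟨by simpa using h ∅ (fun _ => Set.univ) (fun _ => MeasurableSet.univ)⟩

lemma IsProductMeasure.splice_self {X : ℕ → Type*} [∀ i, MeasurableSpace (X i)]
    {μ : Measure (Π i, X i)} {μs : ∀ i, Measure (X i)} (hs : ∀ i, IsProbabilityMeasure (μs i))
    (h : IsProductMeasure μ μs) (n : ℕ) : (μ.prod μ).map (splicePt n) = μ := by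
  have := h.isProb
  have h' := h.splice h n
  simp only [ite_self] at h'
  have e1 : (μ.prod μ).map (splicePt n) = Measure.infinitePi μs :=
    Measure.eq_infinitePi _ fun I s hs => by
      classical
      have := h' I (fun i => if i ∈ I then s i else ∅) (fun i => by
        split_ifs with hi
        · first | exact hs i hi | exact hs i
        · exact MeasurableSet.empty)
      convert this using 1
      · congr 1
        exact Set.pi_congr rfl fun i hi => by simp [Finset.mem_coe.1 hi]
      · exact Finset.prod_congr rfl fun i hi => by simp [hi]
  have e2 : μ = Measure.infinitePi μs :=
    Measure.eq_infinitePi _ fun I s hs => by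
      classical
      have := h I (fun i => if i ∈ I then s i else ∅) (fun i => by
        split_ifs with hi
        · first | exact hs i hi | exact hs i
        · exact MeasurableSet.empty)
      convert this using 1
      · congr 1
        exact Set.pi_congr rfl fun i hi => by simp [Finset.mem_coe.1 hi]
      · exact Finset.prod_congr rfl fun i hi => by simp [hi]
  rw [e1, ← e2]

lemma iSup_piLE_eq (X : ℕ → Type*) [∀ i, MeasurableSpace (X i)] :
    (⨆ n, (Filtration.piLE (X := X) n)) = MeasurableSpace.pi := by
  refine le_antisymm (iSup_le fun n => Filtration.piLE.le n) ?_
  refine iSup_le fun i => ?_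
  refine le_trans ?_ (le_iSup (fun n => (Filtration.piLE (X := X) n : MeasurableSpace _)) i)
  rintro _ ⟨s, hs, rfl⟩
  rw [Filtration.piLE_eq_comap_frestrictLe]
  exact ⟨(fun y : (Π j : Finset.Iic i, X j) => y ⟨i, by simp⟩) ⁻¹' s,
    (measurable_pi_apply (X := fun j : Finset.Iic i => X j) ⟨i, by simp⟩) hs, rfl⟩

lemma splice_tail {X : ℕ → Type*} [∀ i, MeasurableSpace (X i)]
    {μ : Measure (Π i, X i)} {μs : ∀ i, Measure (X i)} (hs : ∀ i, IsProbabilityMeasure (μs i))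
    (h : IsProductMeasure μ μs) (u : (Π i, X i) → ℝ) (hu : Measurable u)
    (C : ℝ) (hC : ∀ x, |u x| ≤ C) (ε : ℝ) (hε : 0 < ε) :
    ∃ N, ∀ n ≥ N, ∫ x, |(∫ y, u (splicePt n (x, y)) ∂μ) - ∫ y, u y ∂μ| ∂μ < ε := by
  have := h.isProb
  have hui : Integrable u μ :=
    Integrable.of_bound hu.aestronglyMeasurable C (Filter.Eventually.of_forall hC)
  have ht := hui.tendsto_eLpNorm_condExp (ℱ := Filtration.piLE (X := X))
    (by rw [iSup_piLE_eq]; exact hu.stronglyMeasurable)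
  obtain ⟨N, hN⟩ := (ht.eventually (gt_mem_nhds (ENNReal.ofReal_pos.2 hε))).exists
  refine ⟨N, fun n hn => ?_⟩
  set g := μ[u | Filtration.piLE (X := X) N] with hg
  have hgi : Integrable g μ := integrable_condExp
  have hgd : DependsOn g (Set.Iic N) :=
    StronglyMeasurable.dependsOn_of_piLE stronglyMeasurable_condExp
  have hgs : ∀ x y, g (splicePt n (x, y)) = g y := fun x y =>
    hgd fun i hi => by simp [splicePt, le_trans (Set.mem_Iic.1 hi) hn]
  have hgE : ∫ y, g y ∂μ = ∫ y, u y ∂μ := integral_condExp (Filtration.piLE.le N)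
  have hmp : MeasurePreserving (splicePt n) (μ.prod μ) μ :=
    ⟨measurable_splicePt n, h.splice_self hs n⟩
  have hdi : Integrable (fun z => |u z - g z|) μ := (hui.sub hgi).abs
  have hdi2 : Integrable (fun p => |u (splicePt n p) - g (splicePt n p)|) (μ.prod μ) :=
    hmp.integrable_comp_of_integrable hdi
  have hus : ∀ x, Integrable (fun y => u (splicePt n (x, y))) μ := fun x =>
    Integrable.of_bound ((hu.comp ((measurable_splicePt n).comp
      measurable_prodMk_left)).aestronglyMeasurable) C (Filter.Eventually.of_forall fun y => hC _)
  have hpt : ∀ x, |(∫ y, u (splicePt n (x, y)) ∂μ) - ∫ y, u y ∂μ| ≤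
      ∫ y, |u (splicePt n (x, y)) - g (splicePt n (x, y))| ∂μ := fun x => by
    rw [← hgE]
    simp only [hgs]
    rw [← integral_sub (hus x) hgi]
    exact abs_integral_le_integral_abs
  calc _ ≤ ∫ x, ∫ y, |u (splicePt n (x, y)) - g (splicePt n (x, y))| ∂μ ∂μ :=
        integral_mono_of_nonneg (Filter.Eventually.of_forall fun x => abs_nonneg _)
          hdi2.integral_prod_left (Filter.Eventually.of_forall hpt)
    _ = ∫ p, |u (splicePt n p) - g (splicePt n p)| ∂(μ.prod μ) := (integral_prod _ hdi2).symm
    _ = ∫ z, |u z - g z| ∂μ := by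
        conv_rhs => rw [← hmp.map_eq]
        rw [integral_map hmp.aemeasurable]
        rw [hmp.map_eq]; exact hdi.aestronglyMeasurable
    _ < ε := by
        have : ∫ z, |u z - g z| ∂μ = (eLpNorm (g - u) 1 μ).toReal := by
          rw [eLpNorm_one_eq_lintegral_enorm, ← integral_norm_eq_lintegral_enorm
            (hgi.sub hui).aestronglyMeasurable]
          exact integral_congr_ae (Filter.Eventually.of_forall fun z => by
            simp [abs_sub_comm])
        rw [this]
        exact ENNReal.toReal_lt_of_lt_ofReal hN

lemma splice_exists {X : ℕ → Type*} [∀ i, MeasurableSpace (X i)] {A : Type*} [Fintype A]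
    {μ : Measure (Π i, X i)} {μs : ∀ i, Measure (X i)} (hs : ∀ i, IsProbabilityMeasure (μs i))
    (h : IsProductMeasure μ μs) (u : A → (Π i, X i) → ℝ) (hu : ∀ a, Measurable (u a))
    (C : ℝ) (hC : ∀ a x, |u a x| ≤ C) (ε : ℝ) (hε : 0 < ε) :
    ∃ ν ∈ FinitisticProductProbSet X, ∀ a, ∫ x, u a x ∂ν ≤ ∫ x, u a x ∂μ + ε := by
  have := h.isProb
  have hε' : 0 < ε / (Fintype.card A + 1) := by positivity
  choose N hN using fun a => splice_tail hs h (u a) (hu a) C (hC a) _ hε'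
  set n := Finset.univ.sup N
  have hn : ∀ a, N a ≤ n := fun a => Finset.le_sup (Finset.mem_univ a)
  let F : A → (Π i, X i) → ℝ := fun a x =>
    |(∫ y, u a (splicePt n (x, y)) ∂μ) - ∫ y, u a y ∂μ|
  have hFi : ∀ a, Integrable (F a) μ := fun a => by
    have h2 : Integrable (fun p => u a (splicePt n p)) (μ.prod μ) :=
      Integrable.of_bound ((hu a).comp (measurable_splicePt n)).aestronglyMeasurable C
        (Filter.Eventually.of_forall fun p => hC a _)
    exact (h2.integral_prod_left.sub (integrable_const _)).abs
  obtain ⟨x, hx⟩ := exists_le_integral (μ := μ) (f := fun x => ∑ a, F a x)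
    (integrable_finsetSum _ fun a _ => hFi a)
  rw [integral_finsetSum _ fun a _ => hFi a] at hx
  have hle : ∑ a, ∫ x, F a x ∂μ ≤ ε := by
    calc _ ≤ ∑ a : A, ε / (Fintype.card A + 1) :=
          Finset.sum_le_sum fun a _ => (hN a n (hn a)).le
      _ = Fintype.card A * (ε / (Fintype.card A + 1)) := by simp
      _ ≤ (Fintype.card A + 1) * (ε / (Fintype.card A + 1)) := by gcongr; linarith
      _ = ε := by field_simp
  refine ⟨((Measure.dirac x).prod μ).map (splicePt n), ⟨_, ?_,
    (isProductMeasure_dirac x).splice h n, ?_⟩, fun a => ?_⟩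
  · intro i
    split_ifs
    · exact hs i
    · infer_instance
  · refine (Set.finite_Iic n).subset fun i hi => ?_
    by_contra hin
    exact hi ⟨x i, by simp only [Set.mem_Iic] at hin; simp [hin]⟩
  · rw [integral_map (measurable_splicePt n).aemeasurable (hu a).aestronglyMeasurable,
      Measure.dirac_prod, integral_map (f := fun p => u a (splicePt n p))
        measurable_prodMk_left.aemeasurable
        ((hu a).comp (measurable_splicePt n)).aestronglyMeasurable]
    have h1 : F a x ≤ ∑ a, F a x :=
      Finset.single_le_sum (f := fun a => F a x) (fun a _ => abs_nonneg _) (Finset.mem_univ a)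
    have h2 := le_abs_self ((∫ y, u a (splicePt n (x, y)) ∂μ) - ∫ y, u a y ∂μ)
    have h3 : F a x ≤ ε := h1.trans (hx.trans hle)
    change _ ≤ F a x at h2
    linarith

end helpers

/-- The minmax value of player 0 equals her finitistic minmax value. -/
theorem minmax_eq_finitistic_minmax
    (X : ℕ → Type*) [∀ i, TopologicalSpace (X i)] [∀ i, PolishSpace (X i)]
    [∀ i, MeasurableSpace (X i)] [∀ i, BorelSpace (X i)]
    (A : Type*) [Fintype A] [Nonempty A]
    (u : A → (Π i, X i) → ℝ) (hu : ∀ a, Measurable (u a))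
    (C : ℝ) (hbd : ∀ a x, |u a x| ≤ C) :
    (⨅ σ : ProductProbSet X, ⨆ a : A, ∫ x, u a x ∂(σ : Measure (Π i, X i))) =
      ⨅ σ : FinitisticProductProbSet X, ⨆ a : A, ∫ x, u a x ∂(σ : Measure (Π i, X i)) := by
  have hsub : ∀ ν ∈ FinitisticProductProbSet X, ν ∈ ProductProbSet X :=
    fun ν ⟨σs, h1, h2, _⟩ => ⟨σs, h1, h2⟩
  have hbb : BddBelow (Set.range fun σ : ProductProbSet X =>
      ⨆ a : A, ∫ x, u a x ∂(σ : Measure (Π i, X i))) := by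
    refine ⟨-C, ?_⟩
    rintro _ ⟨⟨σ, σs, h1, h2⟩, rfl⟩
    have := h2.isProb
    obtain ⟨a⟩ := ‹Nonempty A›
    refine le_trans ?_ (le_ciSup (Set.finite_range _).bddAbove a)
    have := norm_integral_le_of_norm_le_const (μ := σ) (f := u a) (C := C) (Filter.Eventually.of_forall (hbd a))
    simp only [probReal_univ, mul_one, Real.norm_eq_abs] at this
    exact (abs_le.1 this).1
  have hbb' : BddBelow (Set.range fun σ : FinitisticProductProbSet X =>
      ⨆ a : A, ∫ x, u a x ∂(σ : Measure (Π i, X i))) := by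
    refine hbb.mono ?_
    rintro _ ⟨σ, rfl⟩
    exact ⟨⟨σ, hsub _ σ.2⟩, rfl⟩
  rcases isEmpty_or_nonempty (ProductProbSet X) with he | hne
  · have : IsEmpty (FinitisticProductProbSet X) := ⟨fun σ => he.false ⟨σ, hsub _ σ.2⟩⟩
    rw [Real.iInf_of_isEmpty, Real.iInf_of_isEmpty]
  have hne' : Nonempty (FinitisticProductProbSet X) := by
    obtain ⟨σ, σs, h1, h2⟩ := hne
    obtain ⟨ν, hν, _⟩ := splice_exists h1 h2 u hu C hbd 1 one_pos
    exact ⟨⟨ν, hν⟩⟩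
  refine le_antisymm ?_ ?_
  · exact le_ciInf fun σ => ciInf_le hbb ⟨σ, hsub _ σ.2⟩
  · refine le_ciInf fun σ => le_of_forall_pos_le_add fun ε hε => ?_
    obtain ⟨σ, σs, h1, h2⟩ := σ
    obtain ⟨ν, hν, h3⟩ := splice_exists h1 h2 u hu C hbd ε hε
    refine (ciInf_le hbb' ⟨ν, hν⟩).trans (ciSup_le fun a => (h3 a).trans ?_)
    have := le_ciSup (f := fun a => ∫ x, u a x ∂σ) (Set.finite_range _).bddAbove a
    simpa using this
end

section
/- Let $X_i$ ($i \in \mathbb{N}$) be Polish spaces, $X = \prod_{i \in \mathbb{N}} X_i$, $\sigma$ a product of Borel probability measures on $X$, $f : X \to \mathbb{R}$ a bounded Borel-measurable function, and $\varepsilon \geq 0$. Then the set $W_\varepsilon(\sigma,f)$ of weak $\varepsilon$-approximations of the expectation of $f$ under $\sigma$ is an analytic subset of $X$. -/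
open MeasureTheory

lemma wa_analytic (X : ℕ → Type*) [∀ i, TopologicalSpace (X i)] [∀ i, PolishSpace (X i)]
    [∀ i, MeasurableSpace (X i)] [∀ i, BorelSpace (X i)] (n : ℕ) (A : Set (Π i, X i))
    (hA : MeasurableSet A) :
    AnalyticSet {x : Π i, X i | ∃ y ∈ A, ∀ i, n ≤ i → y i = x i} := by
  have h1 : MeasurableSet ((Prod.fst : (Π i, X i) × (Π i, X i) → _) ⁻¹' A) := measurable_fst hA
  have h2 := h1.analyticSet
  have hc : Continuous (fun p : (Π i, X i) × (Π i, X i) =>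
      (fun i => if n ≤ i then p.1 i else p.2 i : Π i, X i)) := by
    refine continuous_pi fun i => ?_
    by_cases h : n ≤ i
    · simp only [h, if_true]; fun_prop
    · simp only [h, if_false]; fun_prop
  convert h2.image_of_continuous hc using 1
  ext x
  constructor
  · rintro ⟨y, hy, hyx⟩
    refine ⟨(y, x), hy, ?_⟩
    funext i
    by_cases h : n ≤ i
    · simp [h, hyx i h]
    · simp [h]
  · rintro ⟨⟨y, z⟩, hy, rfl⟩
    refine ⟨y, hy, fun i hi => by simp [hi]⟩

lemma wa_forward {X : ℕ → Type*} [∀ i, MeasurableSpace (X i)]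
    [∀ i, MeasurableSingletonClass (X i)]
    (f : (Π i, X i) → ℝ) (hf : Measurable f) (C : ℝ) (hbd : ∀ x, |f x| ≤ C)
    (n : ℕ) (x : Π i, X i) (τs : ∀ i, Measure (X i)) (τ : Measure (Π i, X i))
    (h2 : ∀ i, n ≤ i → τs i = Measure.dirac (x i)) (h3 : IsProductMeasure τ τs) :
    (∃ y, f y ≤ ∫ y, f y ∂τ ∧ ∀ i, n ≤ i → y i = x i) ∧
    (∃ y, ∫ y, f y ∂τ ≤ f y ∧ ∀ i, n ≤ i → y i = x i) := by
  have hp : IsProbabilityMeasure τ := ⟨by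
    have := h3 ∅ (fun _ => Set.univ) (fun _ => MeasurableSet.univ)
    simpa using this⟩
  have hint : Integrable f τ :=
    Integrable.of_bound hf.aestronglyMeasurable C (ae_of_all _ fun y => hbd y)
  have hae : ∀ᵐ y ∂τ, ∀ i, n ≤ i → y i = x i := by
    rw [ae_all_iff]
    intro i
    by_cases hi : n ≤ i
    · have := h3 {i} (fun j => {x j}) (fun j => measurableSet_singleton _)
      simp only [Finset.coe_singleton, Finset.prod_singleton, h2 i hi] at this
      have h4 : τ (Set.pi {i} fun j => {x j}) = 1 := by simpa using this
      have h5 : MeasurableSet (Set.pi {i} fun j => ({x j} : Set (X j))) :=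
        MeasurableSet.pi (Set.countable_singleton i) fun j _ => measurableSet_singleton _
      have h6 : ∀ᵐ y ∂τ, y ∈ (Set.pi {i} fun j => ({x j} : Set (X j))) :=
        (prob_compl_eq_zero_iff h5).2 h4
      filter_upwards [h6] with y hy _
      simpa using hy
    · exact ae_of_all _ fun y h => absurd h hi
  obtain ⟨y, hy, hy'⟩ := exists_notMem_null_le_integral hint hae
  obtain ⟨z, hz, hz'⟩ := exists_notMem_null_integral_le hint hae
  exact ⟨⟨y, hy', by simpa using hy⟩, ⟨z, hz', by simpa using hz⟩⟩

lemma wa_mix {X : ℕ → Type*} [∀ i, MeasurableSpace (X i)]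
    [∀ i, MeasurableSingletonClass (X i)]
    (f : (Π i, X i) → ℝ) (hf : Measurable f)
    (n : ℕ) (x y z : Π i, X i) (k : ℕ) (hk : k < n) (hyz : ∀ i, i ≠ k → y i = z i)
    (hyx : ∀ i, n ≤ i → y i = x i) (a : ℝ) (hya : f y ≤ a) (haz : a ≤ f z) :
    ∃ (τs : ∀ i, Measure (X i)) (τ : Measure (Π i, X i)),
    (∀ i, IsProbabilityMeasure (τs i)) ∧
    (∀ i, n ≤ i → τs i = Measure.dirac (x i)) ∧
    IsProductMeasure τ τs ∧ ∫ y, f y ∂τ = a := by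
  obtain ⟨s, t, hs, ht, hst, hE⟩ : ∃ s t : ℝ, 0 ≤ s ∧ 0 ≤ t ∧ s + t = 1 ∧ s * f y + t * f z = a := by
    have : a ∈ segment ℝ (f y) (f z) := by
      rw [segment_eq_Icc (hya.trans haz)]; exact ⟨hya, haz⟩
    obtain ⟨s, t, hs, ht, hst, h⟩ := this
    exact ⟨s, t, hs, ht, hst, by simpa using h⟩
  have hst' : ENNReal.ofReal s + ENNReal.ofReal t = 1 := by
    rw [← ENNReal.ofReal_add hs ht, hst, ENNReal.ofReal_one]
  refine ⟨fun i => ENNReal.ofReal s • Measure.dirac (y i) + ENNReal.ofReal t • Measure.dirac (z i),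
    ENNReal.ofReal s • Measure.dirac y + ENNReal.ofReal t • Measure.dirac z, ?_, ?_, ?_, ?_⟩
  · intro i
    exact ⟨by simp [hst']⟩
  · intro i hi
    beta_reduce
    rw [← hyz i (by omega), ← add_smul, hst', one_smul, hyx i hi]
  · intro I S hS
    have hm : MeasurableSet ((I : Set ℕ).pi S) :=
      MeasurableSet.pi I.countable_toSet fun j _ => hS j
    have hd : ∀ w : Π i, X i, Measure.dirac w ((I : Set ℕ).pi S)
        = ∏ i ∈ I, Measure.dirac (w i) (S i) := by
      intro w
      rw [Measure.dirac_apply' _ hm]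
      simp only [Measure.dirac_apply' _ (hS _)]
      by_cases h : w ∈ (I : Set ℕ).pi S
      · rw [Set.indicator_of_mem h]
        refine (Finset.prod_eq_one fun i hi => ?_).symm
        rw [Set.indicator_of_mem (h i hi)]; rfl
      · rw [Set.indicator_of_notMem h]
        simp only [Set.mem_pi, not_forall] at h
        obtain ⟨i, hi, h⟩ := h
        exact (Finset.prod_eq_zero hi (Set.indicator_of_notMem h _)).symm
    have he : ∀ i, i ≠ k → (ENNReal.ofReal s • Measure.dirac (y i)
        + ENNReal.ofReal t • Measure.dirac (z i)) (S i) = Measure.dirac (y i) (S i) := by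
      intro i hi
      rw [← hyz i hi, ← add_smul, hst', one_smul]
    have he' : ∀ i, i ≠ k → Measure.dirac (z i) (S i) = Measure.dirac (y i) (S i) := by
      intro i hi
      rw [← hyz i hi]
    simp only [Measure.add_apply, Measure.smul_apply, smul_eq_mul, hd] at he ⊢
    by_cases hkI : k ∈ I
    · rw [← Finset.mul_prod_erase _ _ hkI, ← Finset.mul_prod_erase _ _ hkI,
        ← Finset.mul_prod_erase _ _ hkI,
        Finset.prod_congr rfl fun i hi => he i (Finset.ne_of_mem_erase hi),
        Finset.prod_congr rfl fun i hi => he' i (Finset.ne_of_mem_erase hi)]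
      ring
    · have hne : ∀ i ∈ I, i ≠ k := fun i hi h => hkI (h ▸ hi)
      rw [Finset.prod_congr rfl fun i hi => he i (hne i hi),
        Finset.prod_congr rfl fun i hi => he' i (hne i hi), ← add_mul, hst', one_mul]
  · have hi : ∀ w : Π i, X i, Integrable f (Measure.dirac w) := fun w => by
      refine ⟨hf.aestronglyMeasurable, ?_⟩
      rw [HasFiniteIntegral, lintegral_dirac' _ (by fun_prop)]
      simp
    rw [integral_add_measure ((hi y).smul_measure (by simp)) ((hi z).smul_measure (by simp)),
      integral_smul_measure, integral_smul_measure, integral_dirac' _ _ hf.stronglyMeasurable,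
      integral_dirac' _ _ hf.stronglyMeasurable, ENNReal.toReal_ofReal hs, ENNReal.toReal_ofReal ht]
    simpa using hE

lemma wa_backward {X : ℕ → Type*} [∀ i, MeasurableSpace (X i)]
    [∀ i, MeasurableSingletonClass (X i)]
    (f : (Π i, X i) → ℝ) (hf : Measurable f)
    (n : ℕ) (x y z : Π i, X i)
    (hyx : ∀ i, n ≤ i → y i = x i) (hzx : ∀ i, n ≤ i → z i = x i)
    (a b : ℝ) (hab : a ≤ b) (hyb : f y ≤ b) (haz : a ≤ f z) :
    ∃ (m : ℕ) (τs : ∀ i, Measure (X i)) (τ : Measure (Π i, X i)),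
    (∀ i, IsProbabilityMeasure (τs i)) ∧
    (∀ i, m ≤ i → τs i = Measure.dirac (x i)) ∧
    IsProductMeasure τ τs ∧ a ≤ ∫ y, f y ∂τ ∧ ∫ y, f y ∂τ ≤ b := by
  classical
  by_cases hya : a ≤ f y
  · obtain ⟨τs, τ, h1, h2, h3, h4⟩ := wa_mix f hf (n + 1) x y y 0 (by omega) (fun _ _ => rfl)
      (fun i hi => hyx i (by omega)) (f y) le_rfl le_rfl
    exact ⟨n + 1, τs, τ, h1, h2, h3, h4 ▸ hya, h4 ▸ hyb⟩
  push Not at hya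
  let w : ℕ → Π i, X i := fun k i => if i < k then z i else y i
  have hw0 : w 0 = y := by funext i; simp [w]
  have hwn : w n = z := by
    funext i
    by_cases h : i < n
    · simp [w, h]
    · simp [w, h, hyx i (by omega), hzx i (by omega)]
  have hex : ∃ k, a ≤ f (w k) := ⟨n, hwn ▸ haz⟩
  have hle : Nat.find hex ≤ n := Nat.find_min' hex (hwn ▸ haz)
  obtain ⟨k, hk⟩ : ∃ k, Nat.find hex = k + 1 := by
    refine Nat.exists_eq_succ_of_ne_zero fun h => ?_
    have := Nat.find_spec hex
    rw [h, hw0] at this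
    linarith
  have hk1 : a ≤ f (w (k + 1)) := hk ▸ Nat.find_spec hex
  have hk0 : ¬ a ≤ f (w k) := Nat.find_min hex (by omega)
  obtain ⟨τs, τ, h1, h2, h3, h4⟩ := wa_mix f hf n x (w k) (w (k + 1)) k (by omega)
    (fun i hi => by
      have : i < k + 1 ↔ i < k := by omega
      simp [w, this])
    (fun i hi => by
      have : ¬ i < k := by omega
      simp [w, this, hyx i hi]) a (not_le.1 hk0).le hk1
  exact ⟨n, τs, τ, h1, h2, h3, h4.ge, h4 ▸ hab⟩

theorem weakApprox_analyticSet
    (X : ℕ → Type*) [∀ i, TopologicalSpace (X i)] [∀ i, PolishSpace (X i)]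
    [∀ i, MeasurableSpace (X i)] [∀ i, BorelSpace (X i)]
    (σs : ∀ i, Measure (X i)) (hσs : ∀ i, IsProbabilityMeasure (σs i))
    (σ : Measure (Π i, X i)) (hσ : IsProductMeasure σ σs)
    (f : (Π i, X i) → ℝ) (hf : Measurable f) (C : ℝ) (hbd : ∀ x, |f x| ≤ C)
    (ε : ℝ) (hε : 0 ≤ ε) :
    MeasureTheory.AnalyticSet {x | IsWeakApprox σ f ε x} := by
  have key : {x | IsWeakApprox σ f ε x} = ⋃ n : ℕ, ⋂ c : Bool,
      {x : Π i, X i | ∃ y ∈ (if c then {y | f y ≤ ∫ y, f y ∂σ + ε}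
        else {y | ∫ y, f y ∂σ - ε ≤ f y} : Set (Π i, X i)), ∀ i, n ≤ i → y i = x i} := by
    ext x
    simp only [Set.mem_ofPred_eq, Set.mem_iUnion, Set.mem_iInter, Bool.forall_bool]
    constructor
    · rintro ⟨n, τs, τ, h1, h2, h3, h4⟩
      obtain ⟨⟨y, hy, hy'⟩, ⟨z, hz, hz'⟩⟩ := wa_forward f hf C hbd n x τs τ h2 h3
      rw [abs_le] at h4
      refine ⟨n, ⟨z, ?_, hz'⟩, ⟨y, ?_, hy'⟩⟩
      · simp only [Bool.false_eq_true, if_false, Set.mem_ofPred_eq]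
        linarith [h4.1]
      · simp only [if_true, Set.mem_ofPred_eq]
        linarith [h4.2]
    · rintro ⟨n, ⟨z, hz, hz'⟩, ⟨y, hy, hy'⟩⟩
      simp only [Bool.false_eq_true, if_false, if_true, Set.mem_ofPred_eq] at hz hy
      obtain ⟨m, τs, τ, h1, h2, h3, h4, h5⟩ := wa_backward f hf n x y z hy' hz' _ _
        (by linarith) hy hz
      exact ⟨m, τs, τ, h1, h2, h3, abs_le.2 ⟨by linarith, by linarith⟩⟩
  rw [key]
  refine AnalyticSet.iUnion fun n => AnalyticSet.iInter fun c => wa_analytic X n _ ?_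
  cases c
  · exact measurableSet_le measurable_const hf
  · exact measurableSet_le hf measurable_const
end

section
/- Let $X_i = \{0,1\}$ for each $i \in \mathbb{N}$, $X = \{0,1\}^{\mathbb{N}}$, let $f : X \to \mathbb{R}$ be the indicator function of the singleton $\{(1,1,1,\dots)\}$ (i.e., $f(x) = 1$ if $x_i = 1$ for all $i$, and $f(x) = 0$ otherwise), and let $\sigma = \bigotimes_{i \in \mathbb{N}} \sigma_i$ where $\sigma_i(\{1\}) = 1 - 2^{-i}$. Then there is no strong $0$-approximation of the expectation of $f$ under $\sigma$; that is, $S_0(\sigma,f) = \emptyset$. -/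
open scoped Classical

open MeasureTheory

theorem aux_tendsto (μ : Measure (Π _ : ℕ, Bool)) (μs : ∀ _ : ℕ, Measure Bool)
    (h : IsProductMeasure μ μs)
    (f : (Π _ : ℕ, Bool) → ℝ) (hf : ∀ x, f x = if (∀ i, x i = true) then 1 else 0) :
    Filter.Tendsto (fun k => ∏ i ∈ Finset.range k, (μs i).real {true}) Filter.atTop
      (nhds (∫ y, f y ∂μ)) := by
  have huniv : μ Set.univ = 1 := by
    have := h ∅ (fun _ => Set.univ) (fun _ => MeasurableSet.univ)
    simpa using this
  haveI : IsProbabilityMeasure μ := ⟨huniv⟩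
  let A : ℕ → Set (Π _ : ℕ, Bool) := fun k => ((Finset.range k : Finset ℕ) : Set ℕ).pi fun _ => {true}
  have hA : ∀ k, MeasurableSet (A k) := fun k =>
    MeasurableSet.pi (Set.to_countable _) (fun _ _ => MeasurableSet.of_discrete)
  have hanti : Antitone A := by
    intro a b hab x hx i hi
    apply hx i
    simp only [Finset.coe_range, Set.mem_Iio] at hi ⊢
    omega
  have hlim := tendsto_measure_iInter_atTop (μ := μ) (fun k => (hA k).nullMeasurableSet) hanti
    ⟨0, measure_ne_top _ _⟩
  have hInt : ∫ y, f y ∂μ = μ.real (⋂ k, A k) := by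
    rw [← integral_indicator_one (MeasurableSet.iInter hA)]
    congr 1
    funext y
    rw [hf, Set.indicator_apply]
    have : (∀ i, y i = true) ↔ y ∈ ⋂ k, A k := by
      simp only [A, Set.mem_iInter, Set.mem_pi, Finset.coe_range, Set.mem_Iio,
        Set.mem_singleton_iff]
      exact ⟨fun h k i _ => h i, fun h i => h (i+1) i (Nat.lt_succ_self i)⟩
    simp [this]
  rw [hInt]
  have h2 := (ENNReal.tendsto_toReal (measure_ne_top μ (⋂ k, A k))).comp hlim
  refine h2.congr fun k => ?_
  simp only [Function.comp, A]
  rw [h _ _ (fun _ => MeasurableSet.of_discrete), ENNReal.toReal_prod]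
  rfl

theorem aux_lb (k : ℕ) : (1:ℝ)/4 + (2:ℝ)⁻¹ ^ (k+2) ≤
    ∏ i ∈ Finset.range (k+1), (1 - (2:ℝ)⁻¹ ^ (i+1)) := by
  induction k with
  | zero => norm_num
  | succ k ih =>
    rw [Finset.prod_range_succ]
    have ha : (0:ℝ) < (2:ℝ)⁻¹ ^ k := by positivity
    have hb : (2:ℝ)⁻¹ ^ k ≤ 1 := pow_le_one₀ (by norm_num) (by norm_num)
    have e1 : (2:ℝ)⁻¹ ^ (k+2) = (2:ℝ)⁻¹ ^ k / 4 := by ring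
    have e2 : (2:ℝ)⁻¹ ^ (k+1+2) = (2:ℝ)⁻¹ ^ k / 8 := by ring
    have e3 : (2:ℝ)⁻¹ ^ (k+1+1) = (2:ℝ)⁻¹ ^ k / 4 := by ring
    rw [e1] at ih
    rw [e2, e3]
    have := mul_le_mul_of_nonneg_right ih (by linarith : 0 ≤ 1 - (2:ℝ)⁻¹ ^ k / 4)
    nlinarith

/-- For the indicator function `f` of the all-ones point of `{0,1}^ℕ` (where `true`
plays the role of `1`) and the product measure `σ` with `σ i {1} = 1 - 2^{-i}`
(for `i ∈ {1, 2, ...}`, i.e. the `i`-th factor), there is no strong `0`-approximation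
of the expectation of `f` under `σ`. -/
theorem no_strong_zero_approx
    (σs : ∀ _ : ℕ, Measure Bool) (hσs : ∀ i, IsProbabilityMeasure (σs i))
    (hval : ∀ i, σs i {true} = 1 - (2 : ENNReal)⁻¹ ^ (i + 1))
    (σ : Measure (Π _ : ℕ, Bool)) (hσ : IsProductMeasure σ σs)
    (f : (Π _ : ℕ, Bool) → ℝ) (hf : ∀ x, f x = if (∀ i, x i = true) then 1 else 0) :
    {x | IsStrongApprox σs σ f 0 x} = ∅ := by
  have hr : ∀ i, (σs i).real {true} = 1 - (2:ℝ)⁻¹ ^ (i+1) := by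
    intro i
    rw [Measure.real, hval, ENNReal.toReal_sub_of_le _ ENNReal.one_ne_top]
    · simp
    · exact pow_le_one₀ (by simp) (by simp)
  let P : ℕ → ℝ := fun k => ∏ i ∈ Finset.range k, (1 - (2:ℝ)⁻¹ ^ (i+1))
  have hPσ : Filter.Tendsto P Filter.atTop (nhds (∫ y, f y ∂σ)) := by
    have := aux_tendsto σ σs hσ f hf
    simpa only [hr] using this
  have hpos : ∀ k, 0 < P k := by
    intro k
    apply Finset.prod_pos
    intro i _
    have : (2:ℝ)⁻¹ ^ (i+1) < 1 := pow_lt_one₀ (by norm_num) (by norm_num) (by omega)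
    linarith
  have hstep : ∀ k, P (k+1) < P k := by
    intro k
    have h1 : P (k+1) = P k * (1 - (2:ℝ)⁻¹ ^ (k+1)) := Finset.prod_range_succ _ _
    have : (0:ℝ) < (2:ℝ)⁻¹ ^ (k+1) := by positivity
    rw [h1]
    nlinarith [hpos k, mul_pos (hpos k) this]
  have hanti : Antitone P := antitone_nat_of_succ_le fun k => (hstep k).le
  have hlow : (1:ℝ)/4 ≤ ∫ y, f y ∂σ := by
    refine ge_of_tendsto hPσ (Filter.eventually_atTop.2 ⟨1, fun k hk => ?_⟩)
    obtain ⟨m, rfl⟩ := Nat.exists_eq_add_of_le' hk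
    have := aux_lb m
    have h0 : (0:ℝ) < (2:ℝ)⁻¹ ^ (m+2) := by positivity
    show _ ≤ ∏ i ∈ Finset.range (m+1), (1 - (2:ℝ)⁻¹ ^ (i+1))
    linarith
  rw [Set.eq_empty_iff_forall_notMem]
  rintro x ⟨n, τ, hτ, habs⟩
  have heq : ∫ y, f y ∂τ = ∫ y, f y ∂σ := by
    have := abs_nonpos_iff.1 habs
    linarith
  have hPτ := aux_tendsto τ _ hτ f hf
  by_cases hx : ∀ j, n ≤ j → x j = true
  · have hup : ∫ y, f y ∂σ ≤ P (n+1) := hanti.le_of_tendsto hPσ (n+1)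
    have hc : ∫ y, f y ∂τ = P n := by
      refine tendsto_nhds_unique hPτ (tendsto_const_nhds.congr' ?_)
      filter_upwards [Filter.eventually_ge_atTop n] with k hk
      rw [← Finset.prod_range_mul_prod_Ico _ hk, Finset.prod_congr rfl (g := fun i => 1 - (2:ℝ)⁻¹ ^ (i+1)),
        Finset.prod_eq_one (s := Finset.Ico n k), mul_one]
      · intro i hi
        have hi := (Finset.mem_Ico.1 hi).1
        simp [Nat.not_lt.2 hi, hx i hi, Measure.real]
      · intro i hi
        rw [if_pos (Finset.mem_range.1 hi), hr]
    have := hstep n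
    linarith
  · push Not at hx
    obtain ⟨j, hj, hxj⟩ := hx
    have hc : ∫ y, f y ∂τ = 0 := by
      refine tendsto_nhds_unique hPτ (tendsto_const_nhds.congr' ?_)
      filter_upwards [Filter.eventually_gt_atTop j] with k hk
      symm
      apply Finset.prod_eq_zero (Finset.mem_range.2 hk)
      simp [Nat.not_lt.2 hj, hxj, Measure.real]
    linarith
end

section
/- Let $X_i$ ($i \in \mathbb{N}$) be Polish spaces, $X = \prod_{i \in \mathbb{N}} X_i$, $\sigma$ a product of Borel probability measures on $X$, $f : X \to \mathbb{R}$ a bounded Borel-measurable function, and set $r = \mathbb{E}_\sigma[f]$. Let $Z_0$ be the union of all tail equivalence classes $Z$ of $X$ such that $r$ lies in the convex hull of $f(Z)$. Then $Z_0 \subseteq W_0(\sigma,f)$: every point of $Z_0$ is a weak $0$-approximation of the expectation of $f$ under $\sigma$. -/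
open MeasureTheory

/-- The tail equivalence relation: `x ~ y` iff `x i = y i` for all sufficiently
large `i`. -/
def TailEq {X : ℕ → Type*} (x y : Π i, X i) : Prop :=
  ∃ n : ℕ, ∀ i, n ≤ i → x i = y i

lemma aux_mix {X : ℕ → Type*} [∀ i, MeasurableSpace (X i)]
    (y z : Π i, X i) (k : ℕ) (hyz : ∀ i, i ≠ k → y i = z i) (a b : ENNReal) (hab : a + b = 1) :
    IsProductMeasure (a • Measure.dirac y + b • Measure.dirac z)
      (fun i => a • Measure.dirac (y i) + b • Measure.dirac (z i)) := by
  intro I s hs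
  have hm : MeasurableSet ((I : Set ℕ).pi s) :=
    MeasurableSet.pi I.countable_toSet (fun i _ => hs i)
  have key : ∀ w : Π i, X i, Measure.dirac w ((I : Set ℕ).pi s)
      = ∏ i ∈ I, Measure.dirac (w i) (s i) := by
    intro w
    rw [Measure.dirac_apply' _ hm]
    simp_rw [fun i => Measure.dirac_apply' (w i) (hs i)]
    by_cases h : w ∈ (I : Set ℕ).pi s
    · rw [Set.indicator_of_mem h]
      symm
      apply Finset.prod_eq_one
      intro i hi
      rw [Set.indicator_of_mem (h i hi)]
      rfl
    · rw [Set.indicator_of_notMem h]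
      symm
      simp only [Set.mem_pi, not_forall] at h
      obtain ⟨i, hi, h⟩ := h
      exact Finset.prod_eq_zero hi (Set.indicator_of_notMem h _)
  have same : ∀ i, i ≠ k → a * Measure.dirac (y i) (s i) + b * Measure.dirac (z i) (s i)
      = Measure.dirac (z i) (s i) := by
    intro i hi
    rw [hyz i hi, ← add_mul, hab, one_mul]
  simp only [Measure.add_apply, Measure.smul_apply, smul_eq_mul, key]
  by_cases hk : k ∈ I
  · rw [← Finset.mul_prod_erase I _ hk, ← Finset.mul_prod_erase I _ hk,
      ← Finset.mul_prod_erase I _ hk]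
    rw [Finset.prod_congr rfl (fun i hi => same i (Finset.ne_of_mem_erase hi)),
      Finset.prod_congr (g := fun i => Measure.dirac (z i) (s i)) rfl
        (fun i hi => by rw [hyz i (Finset.ne_of_mem_erase hi)])]
    ring
  · have hne : ∀ i ∈ I, i ≠ k := fun i hi h => hk (h ▸ hi)
    rw [Finset.prod_congr rfl (fun i hi => same i (hne i hi)),
      Finset.prod_congr (g := fun i => Measure.dirac (z i) (s i)) rfl
        (fun i hi => by rw [hyz i (hne i hi)]), ← add_mul, hab, one_mul]

/-- If `r = 𝔼_σ[f]` lies in the convex hull of the image under `f` of the tail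
equivalence class of `x`, then `x` is a weak `0`-approximation of the expectation
of `f` under `σ`. -/
theorem Z0_subset_weak_zero_approx
    (X : ℕ → Type*) [∀ i, TopologicalSpace (X i)] [∀ i, PolishSpace (X i)]
    [∀ i, MeasurableSpace (X i)] [∀ i, BorelSpace (X i)]
    (σs : ∀ i, Measure (X i)) (hσs : ∀ i, IsProbabilityMeasure (σs i))
    (σ : Measure (Π i, X i)) (hσ : IsProductMeasure σ σs)
    (f : (Π i, X i) → ℝ) (hf : Measurable f) (C : ℝ) (hbd : ∀ x, |f x| ≤ C)
    (x : Π i, X i)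
    (hx : (∫ y, f y ∂σ) ∈ convexHull ℝ (f '' {y | TailEq y x})) :
    IsWeakApprox σ f 0 x := by
  set r := ∫ y, f y ∂σ with hr
  obtain ⟨y, ⟨n₁, hy⟩, hyr⟩ : ∃ y, TailEq y x ∧ f y ≤ r := by
    by_contra! h
    have : convexHull ℝ (f '' {y | TailEq y x}) ⊆ Set.Ioi r :=
      convexHull_min (by rintro _ ⟨y, hy, rfl⟩; exact h y hy) (convex_Ioi r)
    exact lt_irrefl r (this hx)
  obtain ⟨z, ⟨n₂, hz⟩, hzr⟩ : ∃ y, TailEq y x ∧ r ≤ f y := by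
    by_contra! h
    have : convexHull ℝ (f '' {y | TailEq y x}) ⊆ Set.Iio r :=
      convexHull_min (by rintro _ ⟨y, hy, rfl⟩; exact h y hy) (convex_Iio r)
    exact lt_irrefl r (this hx)
  let p : ℕ → Π i, X i := fun k i => if i < k then z i else y i
  have hp0 : p 0 = y := by funext i; simp [p]
  have hpn : p (n₁ + n₂ + 1) = z := by
    funext i
    by_cases h : i < n₁ + n₂ + 1
    · simp [p, h]
    · simp only [p, h, if_false]
      rw [hy i (by omega), hz i (by omega)]
  obtain ⟨k, h1, h2⟩ : ∃ k, f (p k) ≤ r ∧ r ≤ f (p (k + 1)) := by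
    by_contra! h
    have hle : ∀ k, f (p k) ≤ r := by
      intro k
      induction k with
      | zero => rw [hp0]; exact hyr
      | succ k ih => exact (h k ih).le
    have := h _ (hle (n₁ + n₂))
    rw [hpn] at this
    linarith
  have hseg : r ∈ segment ℝ (f (p k)) (f (p (k + 1))) := by
    rw [segment_eq_Icc (h1.trans h2)]; exact ⟨h1, h2⟩
  obtain ⟨a, b, ha, hb, hab, hc⟩ := hseg
  have hAB : ENNReal.ofReal a + ENNReal.ofReal b = 1 := by
    rw [← ENNReal.ofReal_add ha hb, hab, ENNReal.ofReal_one]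
  have hpk : ∀ i, i ≠ k → p k i = p (k + 1) i := by
    intro i hi
    have : i < k ↔ i < k + 1 := by omega
    simp only [p, this]
  have htail : ∀ m i, n₁ + n₂ ≤ i → p m i = x i := by
    intro m i hi
    simp only [p]
    rw [hy i (by omega), hz i (by omega)]
    simp
  have hint : ∀ w, Integrable f (Measure.dirac w) := fun w =>
    Integrable.of_bound hf.aestronglyMeasurable C (Filter.Eventually.of_forall hbd)
  refine ⟨n₁ + n₂, _, _, ?_, ?_, aux_mix (p k) (p (k + 1)) k hpk _ _ hAB, ?_⟩
  · intro i
    constructor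
    simp [hAB]
  · intro i hi
    simp only [htail _ i hi]
    rw [← add_smul, hAB, one_smul]
  · rw [integral_add_measure ((hint _).smul_measure ENNReal.ofReal_ne_top)
      ((hint _).smul_measure ENNReal.ofReal_ne_top), integral_smul_measure,
      integral_smul_measure, integral_dirac' _ _ hf.stronglyMeasurable,
      integral_dirac' _ _ hf.stronglyMeasurable, ENNReal.toReal_ofReal ha,
      ENNReal.toReal_ofReal hb, hc]
    simp [← hr]
end

section
/- Let $X_i$ ($i \in \mathbb{N}$) be Polish spaces, $X = \prod_{i \in \mathbb{N}} X_i$, $\sigma$ a product of Borel probability measures on $X$, $f : X \to \mathbb{R}$ a bounded Borel-measurable function, and set $r = \mathbb{E}_\sigma[f]$. Let $Z_0$ be the union of all tail equivalence classes $Z$ of $X$ such that $r$ lies in the convex hull of $f(Z)$; equivalently, $Z_0 = \{x \in X : \exists y, z \text{ with } y \sim x, z \sim x, f(y) \leq r \leq f(z)\}$. Then $Z_0$ has outer $\sigma$-measure $1$ (in particular, $Z_0$ is $\sigma$-measurable with $\sigma(Z_0) = 1$). -/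
open MeasureTheory

open MeasureTheory ProbabilityTheory Filter Topology

def Z0splice {X : ℕ → Type*} (n : ℕ) (x y : Π i, X i) : Π i, X i :=
  fun i => if i < n then y i else x i

theorem Z0splice_meas {X : ℕ → Type*} [∀ i, MeasurableSpace (X i)] (n : ℕ) :
    Measurable (fun p : (Π i, X i) × (Π i, X i) => Z0splice n p.1 p.2) := by
  refine measurable_pi_iff.2 fun i => ?_
  unfold Z0splice
  by_cases h : i < n <;> simp only [h, if_true, if_false] <;> fun_prop

theorem Z0splice_map {X : ℕ → Type*} [∀ i, MeasurableSpace (X i)]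
    (σs : ∀ i, Measure (X i)) [hσs : ∀ i, IsProbabilityMeasure (σs i)] (n : ℕ) :
    ((Measure.infinitePi σs).prod (Measure.infinitePi σs)).map
      (fun p => Z0splice n p.1 p.2) = Measure.infinitePi σs := by
  classical
  apply Measure.eq_infinitePi
  intro I t ht
  rw [Measure.map_apply (Z0splice_meas n)
    (MeasurableSet.pi I.countable_toSet fun i _ => ht i)]
  have : (fun p : (Π i, X i) × (Π i, X i) => Z0splice n p.1 p.2) ⁻¹' ((I : Set ℕ).pi t)
      = (((I.filter (fun i => ¬ i < n) : Finset ℕ) : Set ℕ).pi t) ×ˢ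
        (((I.filter (fun i => i < n) : Finset ℕ) : Set ℕ).pi t) := by
    ext ⟨x, y⟩
    simp only [Set.mem_preimage, Set.mem_pi, Set.mem_prod, Finset.coe_filter, Set.mem_ofPred_eq,
      Finset.mem_coe, Z0splice]
    constructor
    · intro h
      refine ⟨fun i hi => ?_, fun i hi => ?_⟩
      · simpa [hi.2] using h i hi.1
      · simpa [hi.2] using h i hi.1
    · rintro ⟨h1, h2⟩ i hi
      by_cases hn : i < n
      · simpa [hn] using h2 i ⟨hi, hn⟩
      · simpa [hn] using h1 i ⟨hi, hn⟩
  rw [this, Measure.prod_prod, Measure.infinitePi_pi _ (fun i _ => ht i),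
    Measure.infinitePi_pi _ (fun i _ => ht i), mul_comm,
    Finset.prod_filter_mul_prod_filter_not]

theorem Z0_sat {X : ℕ → Type*} [∀ i, MeasurableSpace (X i)]
    (σs : ∀ i, Measure (X i)) [hσs : ∀ i, IsProbabilityMeasure (σs i)]
    (B : Set (Π i, X i)) (hB : MeasurableSet B) (hpos : 0 < Measure.infinitePi σs B) :
    ∀ᵐ x ∂(Measure.infinitePi σs), ∃ y, TailEq y x ∧ y ∈ B := by
  set σ := Measure.infinitePi σs with hσ
  obtain ⟨c⟩ : Nonempty (Π i, X i) := σ.nonempty_of_neZero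
  let S : ℕ → Set ((Π i, X i) × (Π i, X i)) := fun n => (fun p => Z0splice n p.1 p.2) ⁻¹' B
  have hS : ∀ n, MeasurableSet (S n) := fun n => Z0splice_meas n hB
  let g : ℕ → (Π i, X i) → ENNReal := fun n x => σ (Prod.mk x ⁻¹' S n)
  have hg : ∀ n, Measurable (g n) := fun n => measurable_measure_prodMk_left (hS n)
  let G : ℕ → Set (Π i, X i) := fun n => {x | 0 < g n x}
  have hG : ∀ n, MeasurableSet (G n) := fun n => measurableSet_lt measurable_const (hg n)
  have hGle : ∀ n, σ B ≤ σ (G n) := by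
    intro n
    have h1 : σ B = ∫⁻ x, g n x ∂σ := by
      have h2 : σ B = (σ.prod σ) (S n) := by
        conv_lhs => rw [hσ, ← Z0splice_map σs n, Measure.map_apply (Z0splice_meas n) hB]
      rw [h2, Measure.prod_apply (hS n)]
    rw [h1, ← lintegral_indicator_one (hG n)]
    refine lintegral_mono fun x => ?_
    by_cases hx : x ∈ G n
    · simpa [hx] using (prob_le_one : σ (Prod.mk x ⁻¹' S n) ≤ 1)
    · have : g n x = 0 := by simpa [G] using hx
      simp [this]
  let s : ℕ → MeasurableSpace (Π i, X i) :=
    fun i => MeasurableSpace.comap (fun x : Π i, X i => x i) inferInstance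
  have hs_le : ∀ n, s n ≤ MeasurableSpace.pi := fun n => (measurable_pi_apply n).comap_le
  have hind : iIndep s σ :=
    (iIndepFun_infinitePi (P := σs) (X := fun i x => x) (fun i => measurable_id)).iIndep
  have hGn : ∀ n k, n ≤ k → MeasurableSet[⨆ i, ⨆ (_ : i ≥ n), s i] (G k) := by
    intro n k hnk
    have hm : @Measurable _ _ (⨆ i, ⨆ (_ : i ≥ n), s i) MeasurableSpace.pi
        (fun x => Z0splice k x c) := by
      refine @measurable_pi_lambda _ _ _ (_) _ _ fun i => ?_
      unfold Z0splice
      by_cases h : i < k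
      · simp only [h, if_true]; exact @measurable_const _ _ _ (_) _
      · simp only [h, if_false]
        refine measurable_iff_comap_le.2 ?_
        exact le_iSup₂_of_le (f := fun i (_ : i ≥ n) => s i) i (by omega) le_rfl
    have : G k = (fun x => Z0splice k x c) ⁻¹' (G k) := by
      have key : ∀ x y, Z0splice k (Z0splice k x c) y = Z0splice k x y := by
        intro x y; funext i; simp only [Z0splice]; split_ifs <;> rfl
      ext x
      simp only [G, g, S, Set.mem_preimage, Set.mem_ofPred_eq, Set.preimage, key]
    rw [this]
    exact hm (hG k)
  let U : ℕ → Set (Π i, X i) := fun m => ⋃ k, G (m + k)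
  have hUanti : Antitone U := by
    intro a b hab x hx
    simp only [U, Set.mem_iUnion] at hx ⊢
    obtain ⟨k, hk⟩ := hx
    exact ⟨b - a + k, by rwa [show a + (b - a + k) = b + k by omega]⟩
  have hTn : ∀ n, (⋂ m, U m) = ⋂ m, U (n + m) := by
    intro n
    apply Set.Subset.antisymm
    · exact Set.subset_iInter fun m => Set.iInter_subset _ _
    · exact Set.subset_iInter fun m => (Set.iInter_subset _ m).trans (hUanti (by omega))
  have htail : MeasurableSet[limsup s atTop] (⋂ m, U m) := by
    rw [limsup_eq_iInf_iSup_of_nat, MeasurableSpace.measurableSet_iInf]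
    intro n
    rw [hTn n]
    refine MeasurableSet.iInter fun m => MeasurableSet.iUnion fun k => hGn n _ (by omega)
  have h01 := measure_zero_or_one_of_measurableSet_limsup_atTop hs_le hind htail
  have hTpos : σ B ≤ σ (⋂ m, U m) := by
    have ht := tendsto_measure_iInter_atTop (μ := σ) (s := U)
      (fun m => (MeasurableSet.iUnion fun k => hG _).nullMeasurableSet) hUanti
      ⟨0, measure_ne_top _ _⟩
    refine ge_of_tendsto' ht fun m => (hGle m).trans (measure_mono ?_)
    exact Set.subset_iUnion (fun k => G (m + k)) 0
  have h1 : σ (⋂ m, U m) = 1 := h01.resolve_left (hpos.trans_le hTpos).ne'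
  have hTm : MeasurableSet (⋂ m, U m) :=
    MeasurableSet.iInter fun m => MeasurableSet.iUnion fun k => hG _
  have hae : ∀ᵐ x ∂σ, x ∈ ⋂ m, U m := (mem_ae_iff_prob_eq_one hTm).2 h1
  filter_upwards [hae] with x hx
  have hx0 := Set.mem_iInter.1 hx 0
  simp only [U, Set.mem_iUnion] at hx0
  obtain ⟨k, hk⟩ := hx0
  obtain ⟨y, hy⟩ := nonempty_of_measure_ne_zero (ne_of_gt hk)
  refine ⟨Z0splice (0 + k) x y, ⟨0 + k, fun i hi => ?_⟩, hy⟩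
  simp only [Z0splice, not_lt.2 hi, if_false]


/-- The set `Z₀` of points `x` whose tail equivalence class contains points `y, z`
with `f y ≤ 𝔼_σ[f] ≤ f z` has (outer) `σ`-measure `1`. -/
theorem Z0_measure_one
    (X : ℕ → Type*) [∀ i, TopologicalSpace (X i)] [∀ i, PolishSpace (X i)]
    [∀ i, MeasurableSpace (X i)] [∀ i, BorelSpace (X i)]
    (σs : ∀ i, Measure (X i)) (hσs : ∀ i, IsProbabilityMeasure (σs i))
    (σ : Measure (Π i, X i)) (hσ : IsProductMeasure σ σs)
    (f : (Π i, X i) → ℝ) (hf : Measurable f) (C : ℝ) (hbd : ∀ x, |f x| ≤ C) :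
    σ {x | ∃ y z, TailEq y x ∧ TailEq z x ∧
        f y ≤ ∫ w, f w ∂σ ∧ ∫ w, f w ∂σ ≤ f z} = 1 := by
  have hσ' : σ = Measure.infinitePi σs := Measure.eq_infinitePi _ hσ
  subst hσ'
  have hint : Integrable f (Measure.infinitePi σs) :=
    Integrable.of_bound hf.aestronglyMeasurable C (Eventually.of_forall hbd)
  have h1 := Z0_sat σs {x | f x ≤ ∫ w, f w ∂(Measure.infinitePi σs)}
    (measurableSet_le hf measurable_const) (measure_le_integral_pos hint)
  have h2 := Z0_sat σs {x | ∫ w, f w ∂(Measure.infinitePi σs) ≤ f x}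
    (measurableSet_le measurable_const hf) (measure_integral_le_pos hint)
  have h3 : ∀ᵐ x ∂(Measure.infinitePi σs), x ∈ {x | ∃ y z, TailEq y x ∧ TailEq z x ∧
        f y ≤ ∫ w, f w ∂(Measure.infinitePi σs) ∧ ∫ w, f w ∂(Measure.infinitePi σs) ≤ f z} := by
    filter_upwards [h1, h2] with x ⟨y, hy, hy'⟩ ⟨z, hz, hz'⟩
    exact ⟨y, z, hy, hz, hy', hz'⟩
  rw [measure_eq_measure_of_null_sdiff (Set.subset_univ _) (by
    rw [← Set.compl_eq_univ_diff]; exact h3), measure_univ]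
end

section
/- Let $X_i$ ($i \in \mathbb{N}$) be Polish spaces, $X = \prod_{i \in \mathbb{N}} X_i$, $\sigma$ a product of Borel probability measures on $X$, and $f : X \to \mathbb{R}$ a bounded Borel-measurable function. Then there exist a point $x \in X$, a coordinate $n \in \mathbb{N}$, and a Borel probability measure $\tau_n$ on $X_n$ such that $\mathbb{E}_{\delta_{x_1} \otimes \cdots \otimes \delta_{x_{n-1}} \otimes \tau_n \otimes \delta_{x_{n+1}} \otimes \delta_{x_{n+2}} \otimes \cdots}[f] = \mathbb{E}_\sigma[f]$; that is, a weak $0$-approximation exists in which $x$ is replaced by a probability measure in only a single coordinate. -/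
open MeasureTheory

open scoped ENNReal in
lemma mix_isProduct {X : ℕ → Type*} [∀ i, MeasurableSpace (X i)] (x : Π i, X i) (n : ℕ) (t : X n)
    (a b : ℝ≥0∞) (hab : a + b = 1) :
    IsProductMeasure (a • Measure.dirac x + b • Measure.dirac (Function.update x n t))
      (Function.update (fun i => Measure.dirac (x i)) n
        (a • Measure.dirac (x n) + b • Measure.dirac t)) := by
  have key : ∀ (y : Π i, X i), IsProductMeasure (Measure.dirac y) (fun i => Measure.dirac (y i)) := by
    intro y I s hs
    rw [← Measure.infinitePi_dirac, Measure.infinitePi_pi _ (fun i _ => hs i)]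
  intro I s hs
  simp only [Measure.add_apply, Measure.smul_apply, smul_eq_mul]
  rw [key x I s hs, key _ I s hs]
  by_cases hn : n ∈ I
  · rw [← Finset.mul_prod_erase I _ hn, ← Finset.mul_prod_erase I _ hn,
      ← Finset.mul_prod_erase I _ hn]
    have h1 : ∏ i ∈ I.erase n, Measure.dirac (Function.update x n t i) (s i)
        = ∏ i ∈ I.erase n, Measure.dirac (x i) (s i) := by
      refine Finset.prod_congr rfl fun i hi => ?_
      rw [Function.update_of_ne (Finset.ne_of_mem_erase hi)]
    have h2 : ∏ i ∈ I.erase n, (Function.update (fun i => Measure.dirac (x i)) n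
        (a • Measure.dirac (x n) + b • Measure.dirac t)) i (s i)
        = ∏ i ∈ I.erase n, Measure.dirac (x i) (s i) := by
      refine Finset.prod_congr rfl fun i hi => ?_
      rw [Function.update_of_ne (Finset.ne_of_mem_erase hi)]
    rw [h1, h2]
    simp only [Function.update_self, Measure.add_apply, Measure.smul_apply, smul_eq_mul]
    ring
  · have h1 : ∏ i ∈ I, Measure.dirac (Function.update x n t i) (s i)
        = ∏ i ∈ I, Measure.dirac (x i) (s i) := by
      refine Finset.prod_congr rfl fun i hi => ?_
      rw [Function.update_of_ne (fun h : i = n => hn (h ▸ hi))]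
    have h2 : ∏ i ∈ I, (Function.update (fun i => Measure.dirac (x i)) n
        (a • Measure.dirac (x n) + b • Measure.dirac t)) i (s i)
        = ∏ i ∈ I, Measure.dirac (x i) (s i) := by
      refine Finset.prod_congr rfl fun i hi => ?_
      rw [Function.update_of_ne (fun h : i = n => hn (h ▸ hi))]
    rw [h1, h2, ← add_mul, hab, one_mul]

lemma tail_zero_one {X : ℕ → Type*} [∀ i, MeasurableSpace (X i)]
    (σs : ∀ i, Measure (X i)) [∀ i, IsProbabilityMeasure (σs i)]
    (A : Set (Π i, X i)) (hA : MeasurableSet A)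
    (hinv : ∀ x n t, x ∈ A → Function.update x n t ∈ A) :
    Measure.infinitePi σs A = 0 ∨ Measure.infinitePi σs A = 1 := by
  have hne : ∀ i, Nonempty (X i) := fun i => nonempty_of_isProbabilityMeasure (σs i)
  let z : Π i, X i := fun i => Classical.choice (hne i)
  have hiff : ∀ x n t, Function.update x n t ∈ A ↔ x ∈ A := by
    intro x n t
    refine ⟨fun h => ?_, hinv x n t⟩
    have := hinv _ n (x n) h
    simpa using this
  have hN : ∀ N : ℕ, ∀ x : Π i, X i, (fun i => if i < N then z i else x i) ∈ A ↔ x ∈ A := by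
    intro N
    induction N with
    | zero => intro x; simp
    | succ N ih =>
      intro x
      rw [← ih x, ← hiff (fun i => if i < N then z i else x i) N (z N)]
      have : (fun i => if i < N + 1 then z i else x i)
          = Function.update (fun i => if i < N then z i else x i) N (z N) := by
        funext i
        by_cases h : i = N
        · subst h; simp
        · rw [Function.update_of_ne h]
          have : i < N + 1 ↔ i < N := by omega
          simp only [this]
      rw [this]
  have hind := ProbabilityTheory.iIndepFun_infinitePi (P := σs) (X := fun i (ω : X i) => ω)
    (fun i => measurable_id)
  refine ProbabilityTheory.measure_zero_or_one_of_measurableSet_limsup_atTop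
    (s := fun i => MeasurableSpace.comap (fun ω : Π i, X i => ω i) inferInstance)
    (fun n => (measurable_pi_apply n).comap_le) hind ?_
  rw [Filter.limsup_eq_iInf_iSup_of_nat, MeasurableSpace.measurableSet_iInf]
  intro N
  have hm : Measurable[⨆ i ≥ N, MeasurableSpace.comap (fun ω : Π i, X i => ω i) inferInstance]
      (fun (x : Π i, X i) i => if i < N then z i else x i) := by
    refine @measurable_pi_lambda _ _ _ (_) _ _ fun i => ?_
    by_cases h : i < N
    · simp only [h, if_true]
      exact @measurable_const _ _ _ (_) _
    · simp only [h, if_false]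
      refine Measurable.mono (comap_measurable _) ?_ le_rfl
      exact le_iSup₂_of_le i (not_lt.mp h) le_rfl
  have := hm hA
  convert this using 1
  ext x
  exact (hN N x).symm

/-- There is a point `x`, a coordinate `n`, and a Borel probability measure in
coordinate `n`, such that the product of the Dirac measures on the `x i` (`i ≠ n`)
with this measure in coordinate `n` gives exactly the expectation of `f` under `σ`. -/
theorem exists_weak_zero_approx_single_coordinate
    (X : ℕ → Type*) [∀ i, TopologicalSpace (X i)] [∀ i, PolishSpace (X i)]
    [∀ i, MeasurableSpace (X i)] [∀ i, BorelSpace (X i)]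
    (σs : ∀ i, Measure (X i)) (hσs : ∀ i, IsProbabilityMeasure (σs i))
    (σ : Measure (Π i, X i)) (hσ : IsProductMeasure σ σs)
    (f : (Π i, X i) → ℝ) (hf : Measurable f) (C : ℝ) (hbd : ∀ x, |f x| ≤ C) :
    ∃ (x : Π i, X i) (n : ℕ) (τs : ∀ i, Measure (X i)) (τ : Measure (Π i, X i)),
      IsProbabilityMeasure (τs n) ∧
      (∀ i, i ≠ n → τs i = Measure.dirac (x i)) ∧
      IsProductMeasure τ τs ∧
      ∫ y, f y ∂τ = ∫ y, f y ∂σ := by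
  classical
  have hσ' : σ = Measure.infinitePi σs := Measure.eq_infinitePi _ hσ
  subst hσ'
  set μ := Measure.infinitePi σs with hμ
  set m := ∫ y, f y ∂μ with hm
  have hint : Integrable f μ :=
    Integrable.of_bound hf.aestronglyMeasurable C (Filter.Eventually.of_forall hbd)
  by_cases heq : ∃ x, f x = m
  · obtain ⟨x, hx⟩ := heq
    refine ⟨x, 0, fun i => Measure.dirac (x i), Measure.dirac x, inferInstance, fun _ _ => rfl,
      ?_, ?_⟩
    · intro I s hs
      rw [← Measure.infinitePi_dirac, Measure.infinitePi_pi _ (fun i _ => hs i)]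
    · rw [integral_dirac' _ _ hf.stronglyMeasurable, hx]
  push Not at heq
  have hi0 : ∫ y, (f y - m) ∂μ = 0 := by
    rw [integral_sub hint (integrable_const m)]; simp [hm]
  have hi : Integrable (fun y => f y - m) μ := hint.sub (integrable_const m)
  have hA : MeasurableSet {x | f x < m} := measurableSet_lt hf measurable_const
  by_cases hex : ∃ x n t, f x < m ∧ m < f (Function.update x n t)
  · obtain ⟨x, n, t, h1, h2⟩ := hex
    set y := Function.update x n t with hy
    have hd : 0 < f y - f x := by linarith
    set a := (f y - m) / (f y - f x) with ha
    set b := (m - f x) / (f y - f x) with hb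
    have ha0 : 0 ≤ a := div_nonneg (by linarith) hd.le
    have hb0 : 0 ≤ b := div_nonneg (by linarith) hd.le
    have hab : ENNReal.ofReal a + ENNReal.ofReal b = 1 := by
      rw [← ENNReal.ofReal_add ha0 hb0, ha, hb, ← add_div,
        show f y - m + (m - f x) = f y - f x by ring, div_self hd.ne', ENNReal.ofReal_one]
    refine ⟨x, n, _, _, ?_, ?_, mix_isProduct x n t _ _ hab, ?_⟩
    · rw [Function.update_self]
      constructor
      simpa using hab
    · intro i hi
      rw [Function.update_of_ne hi]
    · have hid : ∀ w : Π i, X i, Integrable f (Measure.dirac w) := fun w =>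
        Integrable.of_bound hf.aestronglyMeasurable C (Filter.Eventually.of_forall hbd)
      rw [integral_add_measure ((hid x).smul_measure ENNReal.ofReal_ne_top)
        ((hid _).smul_measure ENNReal.ofReal_ne_top), integral_smul_measure, integral_smul_measure,
        integral_dirac' _ _ hf.stronglyMeasurable, integral_dirac' _ _ hf.stronglyMeasurable,
        ENNReal.toReal_ofReal ha0, ENNReal.toReal_ofReal hb0, ← hy, smul_eq_mul, smul_eq_mul,
        ha, hb]
      field_simp
      ring
  exfalso
  push Not at hex
  rcases tail_zero_one σs {x | f x < m} hA
    (fun x n t hx => lt_of_le_of_ne (hex x n t hx) (heq _)) with h | h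
  · have hae : 0 ≤ᵐ[μ] fun y => f y - m := by
      have : ∀ᵐ y ∂μ, ¬ f y < m := measure_eq_zero_iff_ae_notMem.mp h
      filter_upwards [this] with y hy
      simpa using hy
    have h0 := (integral_eq_zero_iff_of_nonneg_ae hae hi).mp hi0
    obtain ⟨y, hy⟩ := h0.exists
    exact heq y (sub_eq_zero.mp hy)
  · have hae : 0 ≤ᵐ[μ] fun y => -(f y - m) := by
      have : ∀ᵐ y ∂μ, f y < m := (mem_ae_iff_prob_eq_one hA).mpr h
      filter_upwards [this] with y hy
      simpa using hy.le
    have h0 := (integral_eq_zero_iff_of_nonneg_ae hae hi.neg).mp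
      (by rw [integral_neg, hi0, neg_zero])
    obtain ⟨y, hy⟩ := h0.exists
    exact heq y (sub_eq_zero.mp (neg_eq_zero.mp hy))
end
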